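/- arXiv:1909.01188 — 7 statements merged into one kernel-verified Lean document; each statement's English description precedes it below -/
import Mathlib

section
/- Let A be a real symmetric n×n matrix whose eigenvalues, ordered by decreasing magnitude as |λ₁| ≥ … ≥ |λ_n|, satisfy |λ_r| > |λ_{r+1}| > 0 for some 1 ≤ r < n, and let V ∈ O_{n,r} be an orthonormal basis of the invariant subspace spanned by eigenvectors for the r largest-magnitude eigenvalues. Let V₀ ∈ O_{n,r} with d₀ := ‖VVᵀ − V₀V₀ᵀ‖₂ satisfying 0 < d₀ < 1, and set Δ₀ := d₀/√(1 − d₀²). Then for every ε > 0 and every natural number k with k ≥ log(Δ₀/ε)/log(|λ_r|/|λ_{r+1}|), if the matrix A^k V₀ has rank r and V_k ∈ O_{n,r} is any orthonormal basis of the column space of A^k V₀, then ‖VVᵀ − V_k V_kᵀ‖₂ ≤ ε. -/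
open Matrix

/-- The spectral norm (ℓ²→ℓ² operator norm) of a real matrix. -/
noncomputable def sNorm {m n : ℕ} (A : Matrix (Fin m) (Fin n) ℝ) : ℝ :=
  ‖LinearMap.toContinuousLinearMap (Matrix.toEuclideanLin A)‖

lemma aux_nonneg {m : ℕ} (x : Fin m → ℝ) : 0 ≤ x ⬝ᵥ x := by
  simpa [dotProduct] using Finset.sum_nonneg (fun i _ => mul_self_nonneg (x i))

lemma aux_zero {m : ℕ} (x : Fin m → ℝ) (h : x ⬝ᵥ x = 0) : x = 0 :=
  dotProduct_self_eq_zero.mp h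

lemma aux_cs {m : ℕ} (x y : Fin m → ℝ) : (x ⬝ᵥ y) ^ 2 ≤ (x ⬝ᵥ x) * (y ⬝ᵥ y) := by
  have := Finset.sum_mul_sq_le_sq_mul_sq Finset.univ x y
  simpa [dotProduct, sq] using this

lemma aux_adj {m p : ℕ} (M : Matrix (Fin m) (Fin p) ℝ) (x : Fin p → ℝ) (y : Fin m → ℝ) :
    (M *ᵥ x) ⬝ᵥ y = x ⬝ᵥ (Mᵀ *ᵥ y) := by
  rw [dotProduct_mulVec, vecMul_transpose]

lemma aux_iso {m p : ℕ} (M : Matrix (Fin m) (Fin p) ℝ) (h : Mᵀ * M = 1) (x y : Fin p → ℝ) :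
    (M *ᵥ x) ⬝ᵥ (M *ᵥ y) = x ⬝ᵥ y := by
  rw [aux_adj, mulVec_mulVec, h, one_mulVec]

lemma aux_norm {m : ℕ} (x : EuclideanSpace ℝ (Fin m)) :
    ‖x‖ ^ 2 = x.ofLp ⬝ᵥ x.ofLp := by
  rw [EuclideanSpace.real_norm_sq_eq]; simp [dotProduct, sq]

lemma aux_sNorm_le {m p : ℕ} (M : Matrix (Fin m) (Fin p) ℝ) (c : ℝ) (hc : 0 ≤ c)
    (h : ∀ x, (M *ᵥ x) ⬝ᵥ (M *ᵥ x) ≤ c ^ 2 * (x ⬝ᵥ x)) : sNorm M ≤ c := by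
  unfold sNorm
  refine ContinuousLinearMap.opNorm_le_bound _ hc fun x => ?_
  refine le_of_sq_le_sq ?_ (by positivity)
  rw [mul_pow, aux_norm, aux_norm]
  simpa using h x.ofLp

lemma aux_le_sNorm {m p : ℕ} (M : Matrix (Fin m) (Fin p) ℝ) (x : Fin p → ℝ) :
    (M *ᵥ x) ⬝ᵥ (M *ᵥ x) ≤ (sNorm M) ^ 2 * (x ⬝ᵥ x) := by
  have h := (LinearMap.toContinuousLinearMap (Matrix.toEuclideanLin M)).le_opNorm (WithLp.toLp 2 x)
  have h2 := pow_le_pow_left₀ (norm_nonneg _) h 2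
  rw [mul_pow, aux_norm, aux_norm] at h2
  simpa [sNorm] using h2

lemma aux_lower {r : ℕ} (C : Matrix (Fin r) (Fin r) ℝ) (c : ℝ) (hc : 0 < c)
    (h : ∀ z, c * (z ⬝ᵥ z) ≤ (C *ᵥ z) ⬝ᵥ (C *ᵥ z)) (y : Fin r → ℝ) :
    c * (y ⬝ᵥ y) ≤ (Cᵀ *ᵥ y) ⬝ᵥ (Cᵀ *ᵥ y) := by
  have hinj : Function.Injective C.mulVecLin := by
    rw [← LinearMap.ker_eq_bot, LinearMap.ker_eq_bot']
    intro z hz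
    apply aux_zero
    have h1 := h z
    have h2 : C *ᵥ z = 0 := by simpa using hz
    rw [h2] at h1
    simp only [dotProduct_zero] at h1
    have := aux_nonneg z
    nlinarith
  obtain ⟨z, hz⟩ := LinearMap.injective_iff_surjective.mp hinj y
  have hz' : C *ᵥ z = y := by simpa using hz
  have h1 := h z
  rw [hz'] at h1
  have h2 : y ⬝ᵥ y = z ⬝ᵥ (Cᵀ *ᵥ y) := by
    conv_lhs => rw [← hz', aux_adj, hz']
  have h3 := aux_cs z (Cᵀ *ᵥ y)
  rw [← h2] at h3
  have hy := aux_nonneg y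
  have hC := aux_nonneg (Cᵀ *ᵥ y)
  rcases hy.eq_or_lt with h0 | h0
  · rw [← h0]; simpa using hC
  · have h4 : c * (y ⬝ᵥ y) * (y ⬝ᵥ y) ≤ (Cᵀ *ᵥ y ⬝ᵥ Cᵀ *ᵥ y) * (y ⬝ᵥ y) := by
      nlinarith [mul_le_mul_of_nonneg_left h3 hc.le, mul_le_mul_of_nonneg_right h1 hC]
    exact le_of_mul_le_mul_right h4 h0

lemma aux_proj {n r : ℕ} (W : Matrix (Fin n) (Fin r) ℝ) (hW : Wᵀ * W = 1) (x : Fin n → ℝ) :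
    (x - W *ᵥ (Wᵀ *ᵥ x)) ⬝ᵥ (x - W *ᵥ (Wᵀ *ᵥ x)) = x ⬝ᵥ x - (Wᵀ *ᵥ x) ⬝ᵥ (Wᵀ *ᵥ x) := by
  have h1 := aux_iso W hW (Wᵀ *ᵥ x) (Wᵀ *ᵥ x)
  have h2 := aux_adj W (Wᵀ *ᵥ x) x
  have h3 := dotProduct_comm x (W *ᵥ (Wᵀ *ᵥ x))
  simp only [sub_dotProduct, dotProduct_sub]
  linarith

lemma aux_perp {n r : ℕ} (W : Matrix (Fin n) (Fin r) ℝ) (hW : Wᵀ * W = 1) (x : Fin n → ℝ) :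
    Wᵀ *ᵥ (x - W *ᵥ (Wᵀ *ᵥ x)) = 0 := by
  rw [mulVec_sub, mulVec_mulVec, hW, one_mulVec, sub_self]

lemma aux_gap {n r : ℕ} (V W : Matrix (Fin n) (Fin r) ℝ) (hV : Vᵀ * V = 1) (hW : Wᵀ * W = 1)
    (δ : ℝ) (h : ∀ z : Fin r → ℝ,
      z ⬝ᵥ z - (Vᵀ *ᵥ (W *ᵥ z)) ⬝ᵥ (Vᵀ *ᵥ (W *ᵥ z)) ≤ δ ^ 2 * (z ⬝ᵥ z)) (x : Fin n → ℝ) :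
    ((V * Vᵀ - W * Wᵀ) *ᵥ x) ⬝ᵥ ((V * Vᵀ - W * Wᵀ) *ᵥ x) ≤ δ ^ 2 * (x ⬝ᵥ x) := by
  have hT : ∀ y : Fin r → ℝ,
      y ⬝ᵥ y - (Wᵀ *ᵥ (V *ᵥ y)) ⬝ᵥ (Wᵀ *ᵥ (V *ᵥ y)) ≤ δ ^ 2 * (y ⬝ᵥ y) := by
    intro y
    by_cases hδ : 0 < 1 - δ ^ 2
    · have := aux_lower (Vᵀ * W) (1 - δ ^ 2) hδ (fun z => by
        have := h z
        rw [← mulVec_mulVec]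
        linarith) y
      rw [transpose_mul, transpose_transpose, ← mulVec_mulVec] at this
      linarith
    · have h1 := aux_nonneg (Wᵀ *ᵥ (V *ᵥ y))
      have h2 := aux_nonneg y
      nlinarith
  set u := x - W *ᵥ (Wᵀ *ᵥ x) with hu
  have huu := aux_proj W hW x
  have hWu := aux_perp W hW x
  rw [← hu] at huu hWu
  set a := Vᵀ *ᵥ u with ha
  have hkey : a ⬝ᵥ a ≤ δ ^ 2 * (u ⬝ᵥ u) := by
    set q := V *ᵥ a - W *ᵥ (Wᵀ *ᵥ (V *ᵥ a)) with hq
    have hqq := aux_proj W hW (V *ᵥ a)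
    rw [← hq, aux_iso V hV] at hqq
    have h1 : q ⬝ᵥ u = a ⬝ᵥ a := by
      rw [hq, sub_dotProduct, aux_adj V, aux_adj W, hWu, dotProduct_zero, sub_zero]
    have h2 := aux_cs q u
    rw [h1] at h2
    have h3 := hT a
    rw [← hqq] at h3
    have h4 := aux_nonneg u
    rcases (aux_nonneg a).eq_or_lt with h0 | h0
    · rw [← h0]; positivity
    · have : (a ⬝ᵥ a) * (a ⬝ᵥ a) ≤ (δ ^ 2 * (u ⬝ᵥ u)) * (a ⬝ᵥ a) := by
        nlinarith [mul_le_mul_of_nonneg_right h3 h4]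
      exact le_of_mul_le_mul_right this h0
  have hb := h (Wᵀ *ᵥ x)
  set b := Wᵀ *ᵥ x with hbdef
  have e : (V * Vᵀ - W * Wᵀ) *ᵥ x = V *ᵥ a - (W *ᵥ b - V *ᵥ (Vᵀ *ᵥ (W *ᵥ b))) := by
    rw [sub_mulVec, ← mulVec_mulVec, ← mulVec_mulVec, ha, hu, mulVec_sub, mulVec_sub]
    abel
  have hp := aux_proj V hV (W *ᵥ b)
  have hperp := aux_perp V hV (W *ᵥ b)
  set s := W *ᵥ b - V *ᵥ (Vᵀ *ᵥ (W *ᵥ b)) with hs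
  rw [aux_iso W hW] at hp
  have h5 : (V *ᵥ a) ⬝ᵥ s = 0 := by rw [aux_adj, hperp, dotProduct_zero]
  have h6 := dotProduct_comm s (V *ᵥ a)
  have h7 := aux_iso V hV a a
  rw [e]
  simp only [sub_dotProduct, dotProduct_sub]
  nlinarith

lemma aux_pow {n : ℕ} (A U : Matrix (Fin n) (Fin n) ℝ) (μ : Fin n → ℝ) (hU : U * Uᵀ = 1)
    (hd : A = U * Matrix.diagonal μ * Uᵀ) (k : ℕ) :
    A ^ k = U * Matrix.diagonal (fun i => μ i ^ k) * Uᵀ := by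
  have hU' : Uᵀ * U = 1 := mul_eq_one_comm.mp hU
  induction k with
  | zero => simp [hU]
  | succ k ih =>
    rw [pow_succ, ih, hd]
    calc _ = U * Matrix.diagonal (fun i => μ i ^ k) * (Uᵀ * U) * Matrix.diagonal μ * Uᵀ := by
          simp only [Matrix.mul_assoc]
      _ = _ := by
          rw [hU', Matrix.mul_one, Matrix.mul_assoc U, diagonal_mul_diagonal]
          simp only [pow_succ]

lemma aux_powsq {n : ℕ} (A U : Matrix (Fin n) (Fin n) ℝ) (μ : Fin n → ℝ) (hU : U * Uᵀ = 1)
    (hd : A = U * Matrix.diagonal μ * Uᵀ) (k : ℕ) (x : Fin n → ℝ) :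
    (A ^ k *ᵥ x) ⬝ᵥ (A ^ k *ᵥ x) = ∑ i, (|μ i| ^ k) ^ 2 * ((Uᵀ *ᵥ x) i) ^ 2 := by
  have hU' : Uᵀ * U = 1 := mul_eq_one_comm.mp hU
  rw [aux_pow A U μ hU hd, ← mulVec_mulVec, ← mulVec_mulVec, aux_iso U hU']
  simp only [dotProduct, mulVec_diagonal]
  refine Finset.sum_congr rfl fun i _ => ?_
  rw [← abs_pow, sq_abs]; ring

lemma aux_one {n : ℕ} (U : Matrix (Fin n) (Fin n) ℝ) (hU : U * Uᵀ = 1) (x : Fin n → ℝ) :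
    x ⬝ᵥ x = ∑ i, ((Uᵀ *ᵥ x) i) ^ 2 := by
  have := aux_iso Uᵀ (by simpa using hU) x x
  rw [← this]; simp [dotProduct, sq]

/-- Convergence of subspace iteration (Theorem 8.2.2 of Golub–Van Loan, adapted).
`μ` lists the eigenvalues of the symmetric matrix `A` in decreasing order of magnitude
(via an orthogonal diagonalization `A = U diag(μ) Uᵀ` with `Antitone |μ|`);
`V` is an orthonormal eigenbasis for the `r` largest-magnitude eigenvalues, and `Vk`
is any orthonormal basis of the column space of `A^k V₀`. -/
theorem subspace_iteration_convergence
    (n r : ℕ) (hr : 1 ≤ r) (hrn : r < n)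
    (A : Matrix (Fin n) (Fin n) ℝ) (hA : Aᵀ = A)
    (μ : Fin n → ℝ) (hmag : Antitone fun i => |μ i|)
    (U : Matrix (Fin n) (Fin n) ℝ) (hU : U * Uᵀ = 1)
    (hdecomp : A = U * Matrix.diagonal μ * Uᵀ)
    (hgap : |μ ⟨r, hrn⟩| < |μ ⟨r - 1, by omega⟩|) (hpos : 0 < |μ ⟨r, hrn⟩|)
    (V : Matrix (Fin n) (Fin r) ℝ) (hV : Vᵀ * V = 1)
    (hVA : A * V = V * Matrix.diagonal fun j : Fin r => μ (Fin.castLE hrn.le j))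
    (V₀ : Matrix (Fin n) (Fin r) ℝ) (hV₀ : V₀ᵀ * V₀ = 1)
    (d₀ : ℝ) (hd₀ : d₀ = sNorm (V * Vᵀ - V₀ * V₀ᵀ)) (hd₀pos : 0 < d₀) (hd₀lt : d₀ < 1)
    (Δ₀ : ℝ) (hΔ₀ : Δ₀ = d₀ / Real.sqrt (1 - d₀ ^ 2))
    (ε : ℝ) (hε : 0 < ε) (k : ℕ)
    (hk : (k : ℝ) ≥ Real.log (Δ₀ / ε) / Real.log (|μ ⟨r - 1, by omega⟩| / |μ ⟨r, hrn⟩|))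
    (hrank : (A ^ k * V₀).rank = r)
    (Vk : Matrix (Fin n) (Fin r) ℝ) (hVk : Vkᵀ * Vk = 1)
    (hspan : LinearMap.range (Matrix.mulVecLin Vk) =
      LinearMap.range (Matrix.mulVecLin (A ^ k * V₀))) :
    sNorm (V * Vᵀ - Vk * Vkᵀ) ≤ ε := by
  have hU' : Uᵀ * U = 1 := mul_eq_one_comm.mp hU
  have hr1 : r - 1 < n := by omega
  set lr := |μ ⟨r - 1, by omega⟩| with hlr
  set ls := |μ ⟨r, hrn⟩| with hls
  -- upper coordinates
  have hbig : ∀ i : Fin n, i.val < r → lr ≤ |μ i| := fun i hi =>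
    hmag (show i ≤ ⟨r - 1, hr1⟩ from by rw [Fin.le_def]; simp; omega)
  have hsmall : ∀ i : Fin n, r ≤ i.val → |μ i| ≤ ls := fun i hi =>
    hmag (show (⟨r, hrn⟩ : Fin n) ≤ i from by rw [Fin.le_def]; simpa using hi)
  -- rows of W = Uᵀ V
  have hW0 : ∀ i : Fin n, r ≤ i.val → ∀ j, (Uᵀ * V) i j = 0 := by
    intro i hi j
    have h1 : Matrix.diagonal μ * (Uᵀ * V)
        = (Uᵀ * V) * Matrix.diagonal fun j : Fin r => μ (Fin.castLE hrn.le j) := by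
      rw [Matrix.mul_assoc, ← hVA, hdecomp]
      simp only [← Matrix.mul_assoc]
      rw [hU', Matrix.one_mul]
    have h2 := congrFun (congrFun h1 i) j
    rw [diagonal_mul, mul_diagonal] at h2
    by_contra hne
    have h3 : μ i = μ (Fin.castLE hrn.le j) := by
      rw [mul_comm] at h2
      exact mul_left_cancel₀ hne h2
    have h4 := hsmall i hi
    have h5 := hbig (Fin.castLE hrn.le j) (by simp)
    rw [h3] at h4
    linarith
  -- square block
  set C : Matrix (Fin r) (Fin r) ℝ := fun i j => (Uᵀ * V) (Fin.castLE hrn.le i) j with hC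
  have hsplit : ∀ f : Fin n → ℝ, (∀ i : Fin n, r ≤ i.val → f i = 0) →
      ∑ i, f i = ∑ i : Fin r, f (Fin.castLE hrn.le i) := by
    intro f hf
    symm
    have := Finset.sum_map Finset.univ (Fin.castLEEmb hrn.le) f
    simp only [Fin.coe_castLEEmb] at this
    rw [← this]
    refine Finset.sum_subset (Finset.subset_univ _) fun i _ hi => hf i ?_
    by_contra hlt
    push Not at hlt
    exact hi (by simpa using ⟨⟨i.val, hlt⟩, by ext; simp⟩)
  have hCC : Cᵀ * C = 1 := by
    have h1 : (Uᵀ * V)ᵀ * (Uᵀ * V) = 1 := by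
      rw [transpose_mul, transpose_transpose, Matrix.mul_assoc, ← Matrix.mul_assoc U, hU,
        Matrix.one_mul, hV]
    rw [← h1]
    ext a b
    rw [mul_apply, mul_apply, hsplit]
    · rfl
    · intro i hi
      rw [hW0 i hi b, mul_zero]
  have hCC' : C * Cᵀ = 1 := mul_eq_one_comm.mp hCC
  have hperp0 : ∀ y : Fin n → ℝ, Vᵀ *ᵥ y = 0 → ∀ i : Fin n, i.val < r → (Uᵀ *ᵥ y) i = 0 := by
    intro y hy i hi
    have h1 : (Uᵀ * V)ᵀ *ᵥ (Uᵀ *ᵥ y) = 0 := by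
      rw [transpose_mul, transpose_transpose, mulVec_mulVec, Matrix.mul_assoc, hU,
        Matrix.mul_one, hy]
    have h2 : Cᵀ *ᵥ (fun i => (Uᵀ *ᵥ y) (Fin.castLE hrn.le i)) = 0 := by
      rw [← h1]
      ext a
      rw [mulVec, mulVec, dotProduct, dotProduct, hsplit]
      · rfl
      · intro i hi
        rw [transpose_apply, hW0 i hi a, zero_mul]
    have h3 := congrArg (fun v => C *ᵥ v) h2
    simp only [mulVec_mulVec, hCC', one_mulVec, mulVec_zero] at h3
    exact congrFun h3 ⟨i.val, hi⟩
  have hin0 : ∀ a : Fin r → ℝ, ∀ i : Fin n, r ≤ i.val → (Uᵀ *ᵥ (V *ᵥ a)) i = 0 := by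
    intro a i hi
    rw [mulVec_mulVec, mulVec, dotProduct]
    exact Finset.sum_eq_zero fun j _ => by rw [hW0 i hi j, zero_mul]
  have hlow : ∀ a : Fin r → ℝ, (lr ^ k) ^ 2 * (a ⬝ᵥ a) ≤
      (A ^ k *ᵥ (V *ᵥ a)) ⬝ᵥ (A ^ k *ᵥ (V *ᵥ a)) := by
    intro a
    rw [← aux_iso V hV a a, aux_one U hU (V *ᵥ a), aux_powsq A U μ hU hdecomp, Finset.mul_sum]
    refine Finset.sum_le_sum fun i _ => ?_
    by_cases hi : i.val < r
    · have := hbig i hi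
      have h0 : 0 ≤ lr := abs_nonneg _
      gcongr
    · rw [hin0 a i (not_lt.mp hi)]; simp
  have hupp : ∀ y : Fin n → ℝ, Vᵀ *ᵥ y = 0 →
      (A ^ k *ᵥ y) ⬝ᵥ (A ^ k *ᵥ y) ≤ (ls ^ k) ^ 2 * (y ⬝ᵥ y) := by
    intro y hy
    rw [aux_one U hU y, aux_powsq A U μ hU hdecomp, Finset.mul_sum]
    refine Finset.sum_le_sum fun i _ => ?_
    by_cases hi : i.val < r
    · rw [hperp0 y hy i hi]; simp
    · have := hsmall i (not_lt.mp hi)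
      gcongr
  -- powers of A and V
  have hAkV : A ^ k * V = V * Matrix.diagonal fun j : Fin r => μ (Fin.castLE hrn.le j) ^ k := by
    clear hk hlow hupp hspan hrank
    induction k with
    | zero => simp
    | succ k ih =>
      rw [pow_succ, Matrix.mul_assoc, hVA, ← Matrix.mul_assoc, ih, Matrix.mul_assoc,
        diagonal_mul_diagonal]
      simp only [pow_succ]
  have hVtA : Vᵀ * A ^ k = (Matrix.diagonal fun j : Fin r => μ (Fin.castLE hrn.le j) ^ k) * Vᵀ := by
    have := congrArg transpose hAkV
    rwa [transpose_mul, transpose_mul, transpose_pow, hA, diagonal_transpose] at this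
  -- the rate
  have hd1 : 0 < 1 - d₀ ^ 2 := by nlinarith
  have hΔpos : 0 < Δ₀ := by rw [hΔ₀]; exact div_pos hd₀pos (Real.sqrt_pos.mpr hd1)
  have hlrpos : 0 < lr := hpos.trans hgap
  have hrate : Δ₀ * ls ^ k ≤ ε * lr ^ k := by
    have hL : 0 < Real.log (lr / ls) := Real.log_pos (by rwa [one_lt_div hpos])
    have h1 : Real.log (Δ₀ / ε) ≤ k * Real.log (lr / ls) := by
      have := hk
      rwa [ge_iff_le, div_le_iff₀ hL] at this
    rw [← Real.log_pow, Real.log_le_log_iff (by positivity) (by positivity), div_pow,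
      div_le_div_iff₀ hε (by positivity)] at h1
    linarith
  have hΔsq : Δ₀ ^ 2 * (1 - d₀ ^ 2) = d₀ ^ 2 := by
    rw [hΔ₀, div_pow, Real.sq_sqrt hd1.le, div_mul_cancel₀ _ hd1.ne']
  refine aux_sNorm_le _ _ hε.le (aux_gap V Vk hV hVk ε fun z => ?_)
  obtain ⟨t, ht⟩ : ∃ t, (A ^ k * V₀) *ᵥ t = Vk *ᵥ z := by
    have : Vk *ᵥ z ∈ LinearMap.range (Matrix.mulVecLin (A ^ k * V₀)) := by
      rw [← hspan]; exact ⟨z, by simp⟩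
    obtain ⟨t, ht⟩ := this
    exact ⟨t, by simpa using ht⟩
  rw [← mulVec_mulVec] at ht
  set x := V₀ *ᵥ t with hx
  -- initial bound
  set a := Vᵀ *ᵥ x with ha
  set y := x - V *ᵥ a with hy
  have hyy := aux_proj V hV x
  have hVy := aux_perp V hV x
  rw [← ha, ← hy] at hyy hVy
  have hinit : y ⬝ᵥ y ≤ d₀ ^ 2 * (x ⬝ᵥ x) := by
    have h1 := aux_le_sNorm (V * Vᵀ - V₀ * V₀ᵀ) x
    rw [← hd₀] at h1
    have h2 : (V * Vᵀ - V₀ * V₀ᵀ) *ᵥ x = - y := by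
      rw [sub_mulVec, ← mulVec_mulVec, ← mulVec_mulVec, hx, mulVec_mulVec t V₀ᵀ, hV₀, one_mulVec,
        ← hx, ← ha, hy]
      abel
    rw [h2] at h1
    simpa using h1
  have hya : y ⬝ᵥ y ≤ Δ₀ ^ 2 * (a ⬝ᵥ a) := by
    have h1 : (y ⬝ᵥ y) * (1 - d₀ ^ 2) ≤ (Δ₀ ^ 2 * (a ⬝ᵥ a)) * (1 - d₀ ^ 2) := by
      have h2 : (Δ₀ ^ 2 * (a ⬝ᵥ a)) * (1 - d₀ ^ 2) = d₀ ^ 2 * (a ⬝ᵥ a) := by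
        linear_combination (a ⬝ᵥ a) * hΔsq
      have h3 : x ⬝ᵥ x = y ⬝ᵥ y + a ⬝ᵥ a := by linarith
      rw [h2]
      rw [h3] at hinit
      linarith
    exact le_of_mul_le_mul_right h1 hd1
  -- iterate
  have hw : A ^ k *ᵥ x = A ^ k *ᵥ (V *ᵥ a) + A ^ k *ᵥ y := by
    rw [← mulVec_add, hy]; congr 1; abel
  have hVAy : Vᵀ *ᵥ (A ^ k *ᵥ y) = 0 := by
    rw [mulVec_mulVec, hVtA, ← mulVec_mulVec, hVy, mulVec_zero]
  obtain ⟨b, hb⟩ : ∃ b, A ^ k *ᵥ (V *ᵥ a) = V *ᵥ b :=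
    ⟨_, by rw [mulVec_mulVec, hAkV, ← mulVec_mulVec]⟩
  have hVw : Vᵀ *ᵥ (Vk *ᵥ z) = b := by
    rw [← ht, hw, mulVec_add, hVAy, add_zero, hb, mulVec_mulVec, hV, one_mulVec]
  have hzz : z ⬝ᵥ z = b ⬝ᵥ b + (A ^ k *ᵥ y) ⬝ᵥ (A ^ k *ᵥ y) := by
    rw [← aux_iso Vk hVk, ← ht, hw, hb]
    have h1 : (V *ᵥ b) ⬝ᵥ (A ^ k *ᵥ y) = 0 := by rw [aux_adj, hVAy, dotProduct_zero]
    have h2 := dotProduct_comm (A ^ k *ᵥ y) (V *ᵥ b)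
    simp only [add_dotProduct, dotProduct_add]
    rw [aux_iso V hV, h2, h1]; ring
  have hl := hlow a
  rw [hb, aux_iso V hV] at hl
  have hu := hupp y hVy
  rw [hVw]
  have hfin : (A ^ k *ᵥ y) ⬝ᵥ (A ^ k *ᵥ y) ≤ ε ^ 2 * (b ⬝ᵥ b) := by
    have hsq : (Δ₀ * ls ^ k) ^ 2 ≤ (ε * lr ^ k) ^ 2 :=
      pow_le_pow_left₀ (by positivity) hrate 2
    have ha0 := aux_nonneg a
    calc _ ≤ (ls ^ k) ^ 2 * (y ⬝ᵥ y) := hu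
      _ ≤ (ls ^ k) ^ 2 * (Δ₀ ^ 2 * (a ⬝ᵥ a)) := by gcongr
      _ = (Δ₀ * ls ^ k) ^ 2 * (a ⬝ᵥ a) := by ring
      _ ≤ (ε * lr ^ k) ^ 2 * (a ⬝ᵥ a) := by gcongr
      _ = ε ^ 2 * ((lr ^ k) ^ 2 * (a ⬝ᵥ a)) := by ring
      _ ≤ ε ^ 2 * (b ⬝ᵥ b) := by gcongr
  have hAy := aux_nonneg (A ^ k *ᵥ y)
  have : ε ^ 2 * (b ⬝ᵥ b) ≤ ε ^ 2 * (z ⬝ᵥ z) := by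
    rw [hzz]; gcongr; linarith
  linarith
end

section
/- Let A be a real symmetric n×n matrix, 1 ≤ r < n, and let V ∈ O_{n,r} be a top-r orthonormal eigenbasis of A. Let V̂ ∈ O_{n,r} satisfy ‖VVᵀ − V̂V̂ᵀ‖₂ ≤ ε for some ε ≥ 0, let Ŵ ∈ O_{n,n−r} satisfy ŴŴᵀ = I − V̂V̂ᵀ, and set B := ŴᵀAŴ. Let 1 ≤ q ≤ n − r, let Y ∈ O_{n−r,q} be a top-q orthonormal eigenbasis of the symmetric matrix B, and let Z ∈ O_{n−r,q} satisfy ‖YYᵀ − ZZᵀ‖₂ ≤ ε. Then for every 1 ≤ i ≤ q, |λ_{r+i}(A) − λ_i(ZᵀBZ)| ≤ 2ρ(A)·ε². -/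
open Matrix

lemma tp_exists {E : Type*} [AddCommGroup E] [Module ℝ E] [FiniteDimensional ℝ E]
    {κ : Type*} [Fintype κ] (L : κ → E →ₗ[ℝ] ℝ) (h : Fintype.card κ < Module.finrank ℝ E) :
    ∃ x : E, x ≠ 0 ∧ ∀ k, L k x = 0 := by
  have h1 : Module.finrank ℝ (κ → ℝ) < Module.finrank ℝ E := by
    rwa [Module.finrank_fintype_fun_eq_card]
  have h2 := LinearMap.ker_ne_bot_of_finrank_lt (f := LinearMap.pi L) h1
  obtain ⟨x, hx, hx0⟩ := (Submodule.ne_bot_iff _).1 h2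
  exact ⟨x, hx0, fun k => congrFun (LinearMap.mem_ker.1 hx) k⟩

lemma tp_dot {m n : ℕ} (M : Matrix (Fin m) (Fin n) ℝ) (x : Fin m → ℝ) (y : Fin n → ℝ) :
    x ⬝ᵥ (M *ᵥ y) = (Mᵀ *ᵥ x) ⬝ᵥ y := by
  rw [Matrix.dotProduct_mulVec, Matrix.mulVec_transpose]

lemma tp_iso {m n : ℕ} (W : Matrix (Fin m) (Fin n) ℝ) (h : Wᵀ * W = 1) (x y : Fin n → ℝ) :
    (W *ᵥ x) ⬝ᵥ (W *ᵥ y) = x ⬝ᵥ y := by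
  rw [tp_dot, Matrix.mulVec_mulVec, h, Matrix.one_mulVec]

lemma tp_pos {n : ℕ} {x : Fin n → ℝ} (h : x ≠ 0) : 0 < x ⬝ᵥ x := by
  have h1 : 0 ≤ x ⬝ᵥ x := Finset.sum_nonneg fun i _ => mul_self_nonneg _
  exact lt_of_le_of_ne h1 fun h2 => h (dotProduct_self_eq_zero.1 h2.symm)

lemma tp_nonneg {n : ℕ} (x : Fin n → ℝ) : 0 ≤ x ⬝ᵥ x :=
  Finset.sum_nonneg fun i _ => mul_self_nonneg _

lemma tp_quad {n : ℕ} (M Q : Matrix (Fin n) (Fin n) ℝ) (d : Fin n → ℝ)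
    (hM : M = Q * diagonal d * Qᵀ) (x : Fin n → ℝ) :
    x ⬝ᵥ (M *ᵥ x) = ∑ j, d j * ((Qᵀ *ᵥ x) j * (Qᵀ *ᵥ x) j) := by
  rw [hM, ← Matrix.mulVec_mulVec, ← Matrix.mulVec_mulVec, tp_dot]
  simp only [dotProduct, Matrix.mulVec_diagonal]
  exact Finset.sum_congr rfl fun j _ => by ring

lemma tp_self {n : ℕ} (Q : Matrix (Fin n) (Fin n) ℝ) (hQ : Q * Qᵀ = 1) (x : Fin n → ℝ) :
    x ⬝ᵥ x = ∑ j, ((Qᵀ *ᵥ x) j * (Qᵀ *ᵥ x) j) := by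
  have := tp_iso Qᵀ (by simpa using hQ) x x
  rw [← this]; rfl

lemma tp_le {n : ℕ} (M Q : Matrix (Fin n) (Fin n) ℝ) (d : Fin n → ℝ)
    (hM : M = Q * diagonal d * Qᵀ) (hQ : Q * Qᵀ = 1) (x : Fin n → ℝ) (t : ℝ)
    (h : ∀ j, t < d j → (Qᵀ *ᵥ x) j = 0) : x ⬝ᵥ (M *ᵥ x) ≤ t * (x ⬝ᵥ x) := by
  rw [tp_quad M Q d hM, tp_self Q hQ, Finset.mul_sum]
  refine Finset.sum_le_sum fun j _ => ?_
  by_cases hj : t < d j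
  · simp [h j hj]
  · exact mul_le_mul_of_nonneg_right (not_lt.1 hj) (mul_self_nonneg _)

lemma tp_ge {n : ℕ} (M Q : Matrix (Fin n) (Fin n) ℝ) (d : Fin n → ℝ)
    (hM : M = Q * diagonal d * Qᵀ) (hQ : Q * Qᵀ = 1) (x : Fin n → ℝ) (t : ℝ)
    (h : ∀ j, d j < t → (Qᵀ *ᵥ x) j = 0) : t * (x ⬝ᵥ x) ≤ x ⬝ᵥ (M *ᵥ x) := by
  rw [tp_quad M Q d hM, tp_self Q hQ, Finset.mul_sum]
  refine Finset.sum_le_sum fun j _ => ?_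
  by_cases hj : d j < t
  · simp [h j hj]
  · exact mul_le_mul_of_nonneg_right (not_lt.1 hj) (mul_self_nonneg _)

lemma tp_split {n r : ℕ} (A : Matrix (Fin n) (Fin n) ℝ) (hA : Aᵀ = A)
    (V : Matrix (Fin n) (Fin r) ℝ) (hV : Vᵀ * V = 1) (d : Fin r → ℝ)
    (hVA : A * V = V * diagonal d) (s : Fin n → ℝ) (hs : Vᵀ *ᵥ s = 0) (b : Fin r → ℝ) :
    (s + V *ᵥ b) ⬝ᵥ (A *ᵥ (s + V *ᵥ b)) = s ⬝ᵥ (A *ᵥ s) + ∑ j, d j * (b j * b j) := by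
  have h1 : A *ᵥ (V *ᵥ b) = V *ᵥ (diagonal d *ᵥ b) := by
    rw [Matrix.mulVec_mulVec, hVA, Matrix.mulVec_mulVec]
  have h2 : s ⬝ᵥ (A *ᵥ (V *ᵥ b)) = 0 := by rw [h1, tp_dot, hs, zero_dotProduct]
  have h3 : (V *ᵥ b) ⬝ᵥ (A *ᵥ s) = 0 := by rw [tp_dot, hA, dotProduct_comm, h2]
  have h4 : (V *ᵥ b) ⬝ᵥ (A *ᵥ (V *ᵥ b)) = ∑ j, d j * (b j * b j) := by
    rw [h1, tp_iso V hV]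
    simp only [dotProduct, Matrix.mulVec_diagonal]
    exact Finset.sum_congr rfl fun j _ => by ring
  rw [Matrix.mulVec_add, add_dotProduct, dotProduct_add, dotProduct_add, h2, h3, h4]
  ring

lemma tp_split_self {n r : ℕ}
    (V : Matrix (Fin n) (Fin r) ℝ) (hV : Vᵀ * V = 1) (s : Fin n → ℝ) (hs : Vᵀ *ᵥ s = 0)
    (b : Fin r → ℝ) :
    (s + V *ᵥ b) ⬝ᵥ (s + V *ᵥ b) = s ⬝ᵥ s + ∑ j, (b j * b j) := by
  have h2 : s ⬝ᵥ (V *ᵥ b) = 0 := by rw [tp_dot, hs, zero_dotProduct]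
  have h3 : (V *ᵥ b) ⬝ᵥ s = 0 := by rw [dotProduct_comm, h2]
  rw [add_dotProduct, dotProduct_add, dotProduct_add, h2, h3, tp_iso V hV]
  simp [dotProduct]

lemma tp_norm {m n : ℕ} (M : Matrix (Fin m) (Fin n) ℝ) (ε : ℝ) (h : sNorm M ≤ ε)
    (x : Fin n → ℝ) : (M *ᵥ x) ⬝ᵥ (M *ᵥ x) ≤ ε ^ 2 * (x ⬝ᵥ x) := by
  have e : ∀ {k : ℕ} (v : Fin k → ℝ), v ⬝ᵥ v = ‖WithLp.toLp 2 v‖ ^ 2 := by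
    intro k v
    rw [EuclideanSpace.norm_sq_eq]
    simp [dotProduct, sq]
  have h1 := (LinearMap.toContinuousLinearMap (Matrix.toEuclideanLin M)).le_opNorm
    (WithLp.toLp 2 x)
  have h2 : ‖WithLp.toLp 2 (M *ᵥ x)‖ ≤ ε * ‖WithLp.toLp 2 x‖ := by
    refine le_trans ?_ (mul_le_mul_of_nonneg_right h (norm_nonneg _))
    exact h1
  rw [e, e, ← mul_pow]
  exact pow_le_pow_left₀ (norm_nonneg _) h2 2

lemma tp_comp {n m : ℕ} (A : Matrix (Fin n) (Fin n) ℝ) (W : Matrix (Fin n) (Fin m) ℝ)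
    (x : Fin m → ℝ) : x ⬝ᵥ ((Wᵀ * A * W) *ᵥ x) = (W *ᵥ x) ⬝ᵥ (A *ᵥ (W *ᵥ x)) := by
  rw [← Matrix.mulVec_mulVec, ← Matrix.mulVec_mulVec, tp_dot, Matrix.transpose_transpose]

/-- The functional `x ↦ (M x) j`. -/
noncomputable def tpRow {m n : ℕ} (M : Matrix (Fin m) (Fin n) ℝ) (j : Fin m) :
    (Fin n → ℝ) →ₗ[ℝ] ℝ := LinearMap.proj j ∘ₗ Matrix.mulVecLin M

lemma tpRow_apply {m n : ℕ} (M : Matrix (Fin m) (Fin n) ℝ) (j : Fin m) (x : Fin n → ℝ) :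
    tpRow M j x = (M *ᵥ x) j := rfl

lemma tp_card_lt {n : ℕ} (k : ℕ) (hk : k ≤ n) :
    Fintype.card {j : Fin n // j.val < k} = k := by
  rw [Fintype.card_subtype, Fin.card_filter_val_lt, min_eq_right hk]

lemma tp_card_gt {n : ℕ} (k : ℕ) (hk : k < n) :
    Fintype.card {j : Fin n // k < j.val} = n - 1 - k := by
  have h := Fintype.card_subtype_compl (fun j : Fin n => j.val < k + 1)
  rw [tp_card_lt _ hk, Fintype.card_fin] at h
  rw [← Nat.sub_add_eq, add_comm 1 k, ← h]
  exact Fintype.card_congr (Equiv.subtypeEquivRight fun j => by omega)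

/-- compression of the first phase: lower interlacing -/
lemma tp_inter1 (n r : ℕ) (hrn : r < n)
    (A : Matrix (Fin n) (Fin n) ℝ)
    (μ : Fin n → ℝ) (hμmono : Antitone μ)
    (U : Matrix (Fin n) (Fin n) ℝ) (hU : U * Uᵀ = 1)
    (hdecomp : A = U * Matrix.diagonal μ * Uᵀ)
    (Vh : Matrix (Fin n) (Fin r) ℝ)
    (Wh : Matrix (Fin n) (Fin (n - r)) ℝ) (hWh : Whᵀ * Wh = 1)
    (hWhproj : Wh * Whᵀ = 1 - Vh * Vhᵀ)
    (ν : Fin (n - r) → ℝ) (hνmono : Antitone ν)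
    (P : Matrix (Fin (n - r)) (Fin (n - r)) ℝ) (hP : P * Pᵀ = 1)
    (hB : Whᵀ * A * Wh = P * Matrix.diagonal ν * Pᵀ)
    (i : Fin (n - r)) (l : Fin n) (hl : l.val = r + i.val) : μ l ≤ ν i := by
  obtain ⟨x, hx0, hx⟩ := tp_exists (E := Fin n → ℝ)
    (κ := {j : Fin n // l.val < j.val} ⊕ (Fin r ⊕ {j : Fin (n - r) // j.val < i.val}))
    (Sum.elim (fun j => tpRow Uᵀ j.1) (Sum.elim (fun j => tpRow Vhᵀ j)
      (fun j => tpRow (Pᵀ * Whᵀ) j.1)))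
    (by
      have := i.isLt
      rw [Fintype.card_sum, Fintype.card_sum, tp_card_gt _ l.isLt, tp_card_lt _ i.isLt.le,
        Module.finrank_fintype_fun_eq_card, Fintype.card_fin, Fintype.card_fin]
      omega)
  have h1 : ∀ j : Fin n, l < j → (Uᵀ *ᵥ x) j = 0 := fun j hj => hx (Sum.inl ⟨j, hj⟩)
  have h2 : Vhᵀ *ᵥ x = 0 := funext fun j => hx (Sum.inr (Sum.inl j))
  have h3 : ∀ j : Fin (n - r), j < i → (Pᵀ *ᵥ (Whᵀ *ᵥ x)) j = 0 := fun j hj => by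
    rw [Matrix.mulVec_mulVec]; exact hx (Sum.inr (Sum.inr ⟨j, hj⟩))
  have hw : Wh *ᵥ (Whᵀ *ᵥ x) = x := by
    rw [Matrix.mulVec_mulVec, hWhproj, Matrix.sub_mulVec, Matrix.one_mulVec,
      ← Matrix.mulVec_mulVec, h2, Matrix.mulVec_zero, sub_zero]
  have g1 := tp_ge A U μ hdecomp hU x (μ l) fun j hj => h1 j (by
    by_contra h; exact absurd (hμmono (not_lt.1 h)) (not_le.2 hj))
  have g2 := tp_le _ P ν hB hP (Whᵀ *ᵥ x) (ν i) fun j hj => h3 j (by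
    by_contra h; exact absurd (hνmono (not_lt.1 h)) (not_le.2 hj))
  rw [tp_comp, hw] at g2
  have g3 := tp_iso Wh hWh (Whᵀ *ᵥ x) (Whᵀ *ᵥ x)
  rw [hw] at g3
  rw [← g3] at g2
  exact le_of_mul_le_mul_right (g1.trans g2) (tp_pos hx0)

lemma tp_inter2 (m q : ℕ) (hqm : q ≤ m)
    (B : Matrix (Fin m) (Fin m) ℝ)
    (ν : Fin m → ℝ) (hνmono : Antitone ν)
    (P : Matrix (Fin m) (Fin m) ℝ) (hP : P * Pᵀ = 1)
    (hB : B = P * Matrix.diagonal ν * Pᵀ)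
    (Z : Matrix (Fin m) (Fin q) ℝ) (hZ : Zᵀ * Z = 1)
    (ξ : Fin q → ℝ) (hξmono : Antitone ξ)
    (Pz : Matrix (Fin q) (Fin q) ℝ) (hPz : Pz * Pzᵀ = 1)
    (hZBZ : Zᵀ * B * Z = Pz * Matrix.diagonal ξ * Pzᵀ)
    (i : Fin q) : ξ i ≤ ν (Fin.castLE hqm i) := by
  obtain ⟨x, hx0, hx⟩ := tp_exists (E := Fin q → ℝ)
    (κ := {j : Fin q // i.val < j.val} ⊕ {j : Fin m // j.val < i.val})
    (Sum.elim (fun j => tpRow Pzᵀ j.1) (fun j => tpRow (Pᵀ * Z) j.1))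
    (by
      have := i.isLt
      rw [Fintype.card_sum, tp_card_gt _ i.isLt, tp_card_lt _ (i.isLt.le.trans hqm),
        Module.finrank_fintype_fun_eq_card, Fintype.card_fin]
      omega)
  have g1 := tp_ge _ Pz ξ hZBZ hPz x (ξ i) fun j hj => hx (Sum.inl ⟨j, by
    by_contra h; exact absurd (hξmono (not_lt.1 h)) (not_le.2 hj)⟩)
  have g2 := tp_le B P ν hB hP (Z *ᵥ x) (ν (Fin.castLE hqm i)) fun j hj => by
    rw [Matrix.mulVec_mulVec]
    exact hx (Sum.inr ⟨j, by
      by_contra h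
      exact absurd (hνmono (show Fin.castLE hqm i ≤ j from not_lt.1 h)) (not_le.2 hj)⟩)
  rw [tp_comp] at g1
  rw [tp_iso Z hZ] at g2
  exact le_of_mul_le_mul_right (g1.trans g2) (tp_pos hx0)

lemma tp_part1 (m q : ℕ) (hqm : q ≤ m)
    (B : Matrix (Fin m) (Fin m) ℝ) (hBs : Bᵀ = B) (ρ ε : ℝ)
    (hρ : ∀ x, -ρ * (x ⬝ᵥ x) ≤ x ⬝ᵥ (B *ᵥ x))
    (ν : Fin m → ℝ) (hνmono : Antitone ν) (hνρ : ∀ i, |ν i| ≤ ρ)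
    (Y : Matrix (Fin m) (Fin q) ℝ) (hY : Yᵀ * Y = 1)
    (hYB : B * Y = Y * Matrix.diagonal fun j : Fin q => ν (Fin.castLE hqm j))
    (Z : Matrix (Fin m) (Fin q) ℝ) (hZ : Zᵀ * Z = 1)
    (hZdist : sNorm (Y * Yᵀ - Z * Zᵀ) ≤ ε)
    (ξ : Fin q → ℝ) (hξmono : Antitone ξ)
    (Pz : Matrix (Fin q) (Fin q) ℝ) (hPz : Pz * Pzᵀ = 1)
    (hZBZ : Zᵀ * B * Z = Pz * Matrix.diagonal ξ * Pzᵀ)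
    (i : Fin q) : ν (Fin.castLE hqm i) ≤ ξ i + 2 * ρ * ε ^ 2 := by
  obtain ⟨x, hx0, hx⟩ := tp_exists (E := Fin q → ℝ)
    (κ := {j : Fin q // j.val < i.val} ⊕ {j : Fin q // i.val < j.val})
    (Sum.elim (fun j => tpRow Pzᵀ j.1) (fun j => tpRow (Yᵀ * Z) j.1))
    (by
      have := i.isLt
      rw [Fintype.card_sum, tp_card_gt _ i.isLt, tp_card_lt _ i.isLt.le,
        Module.finrank_fintype_fun_eq_card, Fintype.card_fin]
      omega)
  have g1 := tp_le _ Pz ξ hZBZ hPz x (ξ i) fun j hj => hx (Sum.inl ⟨j, by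
    by_contra h; exact absurd (hξmono (not_lt.1 h)) (not_le.2 hj)⟩)
  rw [tp_comp] at g1
  have g0 := tp_iso Z hZ x x
  have hc : ∀ j : Fin q, i < j → (Yᵀ *ᵥ (Z *ᵥ x)) j = 0 := fun j hj => by
    rw [Matrix.mulVec_mulVec]; exact hx (Sum.inr ⟨j, hj⟩)
  have hzz : Z *ᵥ (Zᵀ *ᵥ (Z *ᵥ x)) = Z *ᵥ x := by
    rw [Matrix.mulVec_mulVec x, hZ, Matrix.one_mulVec]
  have hpos := tp_pos hx0
  rw [← g0] at g1 hpos
  generalize Z *ᵥ x = z at *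
  set c := Yᵀ *ᵥ z with hcdef
  set s := z - Y *ᵥ c with hs
  have hs0 : Yᵀ *ᵥ s = 0 := by
    rw [hs, Matrix.mulVec_sub, Matrix.mulVec_mulVec, hY, Matrix.one_mulVec, hcdef, sub_self]
  have hz : z = s + Y *ᵥ c := by rw [hs]; abel
  have e1 := tp_split B hBs Y hY _ hYB s hs0 c
  have e2 := tp_split_self Y hY s hs0 c
  rw [← hz] at e1 e2
  have e3 := tp_norm _ ε hZdist z
  have e4 : (Y * Yᵀ - Z * Zᵀ) *ᵥ z = -s := by
    rw [Matrix.sub_mulVec, ← Matrix.mulVec_mulVec, ← Matrix.mulVec_mulVec, hzz, hs]; abel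
  rw [e4, neg_dotProduct, dotProduct_neg, neg_neg] at e3
  have e5 := hρ s
  have e6 : ν (Fin.castLE hqm i) * ∑ j, c j * c j
      ≤ ∑ j, ν (Fin.castLE hqm j) * (c j * c j) := by
    rw [Finset.mul_sum]
    refine Finset.sum_le_sum fun j _ => ?_
    by_cases hj : i < j
    · simp [hc j hj]
    · exact mul_le_mul_of_nonneg_right (hνmono (not_lt.1 hj)) (mul_self_nonneg _)
  have e7 := abs_le.1 (hνρ (Fin.castLE hqm i))
  have e8 := tp_nonneg s
  refine le_of_mul_le_mul_right ?_ hpos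
  have e9 : (ν (Fin.castLE hqm i) + ρ) * (s ⬝ᵥ s) ≤ 2 * ρ * (ε ^ 2 * (z ⬝ᵥ z)) :=
    mul_le_mul (by linarith) e3 e8 (by linarith)
  have e10 : ν (Fin.castLE hqm i) * (z ⬝ᵥ z) = ν (Fin.castLE hqm i) * (s ⬝ᵥ s) +
    ν (Fin.castLE hqm i) * ∑ j, c j * c j := by rw [e2]; ring
  linarith

lemma tp_part2 (n r : ℕ) (hrn : r < n)
    (A : Matrix (Fin n) (Fin n) ℝ) (hA : Aᵀ = A)
    (μ : Fin n → ℝ) (hμmono : Antitone μ) (ρ : ℝ) (hρ : ∀ i, |μ i| ≤ ρ)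
    (U : Matrix (Fin n) (Fin n) ℝ) (hU : U * Uᵀ = 1)
    (hdecomp : A = U * Matrix.diagonal μ * Uᵀ)
    (V : Matrix (Fin n) (Fin r) ℝ) (hV : Vᵀ * V = 1)
    (hVA : A * V = V * Matrix.diagonal fun j : Fin r => μ (Fin.castLE hrn.le j))
    (ε : ℝ)
    (Vh : Matrix (Fin n) (Fin r) ℝ) (hVh : Vhᵀ * Vh = 1)
    (hdist : sNorm (V * Vᵀ - Vh * Vhᵀ) ≤ ε)
    (Wh : Matrix (Fin n) (Fin (n - r)) ℝ) (hWh : Whᵀ * Wh = 1)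
    (hWhproj : Wh * Whᵀ = 1 - Vh * Vhᵀ)
    (ν : Fin (n - r) → ℝ) (hνmono : Antitone ν)
    (P : Matrix (Fin (n - r)) (Fin (n - r)) ℝ) (hP : P * Pᵀ = 1)
    (hB : Whᵀ * A * Wh = P * Matrix.diagonal ν * Pᵀ)
    (i : Fin (n - r)) (l : Fin n) (hl : l.val = r + i.val) :
    ν i ≤ μ l + 2 * ρ * ε ^ 2 := by
  have hcard : Fintype.card {j : Fin n // μ l < μ j} ≤
      Fintype.card {j : Fin r // μ l < μ (Fin.castLE hrn.le j)} + i.val := by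
    have : Fintype.card ({j : Fin r // μ l < μ (Fin.castLE hrn.le j)} ⊕ Fin i.val) =
      Fintype.card {j : Fin r // μ l < μ (Fin.castLE hrn.le j)} + i.val := by
      rw [Fintype.card_sum, Fintype.card_fin]
    rw [← this]
    have hlt : ∀ j : Fin n, μ l < μ j → j.val < r + i.val := fun j hj => by
      rw [← hl]; by_contra h; exact absurd (hμmono (not_lt.1 h)) (not_le.2 hj)
    refine Fintype.card_le_of_injective (fun j => if h : j.1.val < r then
      Sum.inl ⟨⟨j.1.val, h⟩, j.2⟩ else Sum.inr ⟨j.1.val - r, by have := hlt j.1 j.2; omega⟩) ?_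
    rintro ⟨a, ha⟩ ⟨b, hb⟩ hab
    apply Subtype.ext; apply Fin.ext
    dsimp only at hab ⊢
    split_ifs at hab with h1 h2 h2
    · simpa using hab
    · simp at hab; omega
  have hcompl : Fintype.card {j : Fin r // ¬ μ l < μ (Fin.castLE hrn.le j)} +
      Fintype.card {j : Fin r // μ l < μ (Fin.castLE hrn.le j)} = r := by
    have h := Fintype.card_subtype_compl (fun j : Fin r => μ l < μ (Fin.castLE hrn.le j))
    have h' := Fintype.card_subtype_le (fun j : Fin r => μ l < μ (Fin.castLE hrn.le j))
    rw [Fintype.card_fin] at h h'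
    omega
  obtain ⟨⟨x, a⟩, hx0, hx⟩ := tp_exists (E := (Fin (n - r) → ℝ) × (Fin r → ℝ))
    (κ := {j : Fin (n - r) // i.val < j.val} ⊕
      ({j : Fin r // ¬ μ l < μ (Fin.castLE hrn.le j)} ⊕ {j : Fin n // μ l < μ j}))
    (Sum.elim (fun j => tpRow Pᵀ j.1 ∘ₗ LinearMap.fst ℝ _ _)
      (Sum.elim (fun j => LinearMap.proj j.1 ∘ₗ LinearMap.snd ℝ _ _)
      (fun j => tpRow (Uᵀ * Wh) j.1 ∘ₗ LinearMap.fst ℝ _ _ -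
        tpRow (Uᵀ * V) j.1 ∘ₗ LinearMap.snd ℝ _ _)))
    (by
      have := i.isLt
      rw [Fintype.card_sum, Fintype.card_sum, tp_card_gt _ i.isLt,
        Module.finrank_prod, Module.finrank_fintype_fun_eq_card,
        Module.finrank_fintype_fun_eq_card, Fintype.card_fin, Fintype.card_fin]
      omega)
  have h1 : ∀ j : Fin (n - r), i < j → (Pᵀ *ᵥ x) j = 0 := fun j hj => hx (Sum.inl ⟨j, hj⟩)
  have h2 : ∀ j : Fin r, ¬ μ l < μ (Fin.castLE hrn.le j) → a j = 0 :=
    fun j hj => hx (Sum.inr (Sum.inl ⟨j, hj⟩))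
  have h3 : ∀ j : Fin n, μ l < μ j → (Uᵀ *ᵥ (Wh *ᵥ x - V *ᵥ a)) j = 0 := fun j hj => by
    rw [Matrix.mulVec_sub, Matrix.mulVec_mulVec, Matrix.mulVec_mulVec]
    exact hx (Sum.inr (Sum.inr ⟨j, hj⟩))
  have g0 := tp_le A U μ hdecomp hU _ (μ l) h3
  have hxne : x ≠ 0 := by
    rintro rfl
    have ha : a = 0 := by
      have e1 := tp_split A hA V hV _ hVA 0 (Matrix.mulVec_zero _) (-a)
      have e2 := tp_split_self V hV 0 (Matrix.mulVec_zero _) (-a)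
      have e3 : Wh *ᵥ 0 - V *ᵥ a = 0 + V *ᵥ (-a) := by
        rw [Matrix.mulVec_zero, Matrix.mulVec_neg]; abel
      rw [e3, e1, e2] at g0
      simp only [Matrix.mulVec_zero, dotProduct_zero, zero_add, Pi.neg_apply, neg_mul_neg,
        Finset.mul_sum] at g0
      have hle : ∀ j ∈ Finset.univ, μ l * (a j * a j) ≤ μ (Fin.castLE hrn.le j) * (a j * a j) :=
        fun j _ => mul_le_mul_of_nonneg_right (hμmono (by
          rw [Fin.le_def, hl]; simp; have := j.isLt; omega)) (mul_self_nonneg _)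
      have heq := (Finset.sum_eq_sum_iff_of_le hle).1 (le_antisymm (Finset.sum_le_sum hle) g0)
      funext j
      by_contra hj
      have hj' : μ l < μ (Fin.castLE hrn.le j) := by
        by_contra h; exact hj (h2 j h)
      have := mul_lt_mul_of_pos_right hj' (mul_self_pos.2 hj)
      exact absurd (heq j (Finset.mem_univ _)) this.ne
    exact hx0 (by rw [ha]; rfl)
  have g1 := tp_ge _ P ν hB hP x (ν i) fun j hj => h1 j (by
    by_contra h; exact absurd (hνmono (not_lt.1 h)) (not_le.2 hj))
  rw [tp_comp] at g1
  have g2 := tp_iso Wh hWh x x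
  have hVh0 : Vh *ᵥ (Vhᵀ *ᵥ (Wh *ᵥ x)) = 0 := by
    have : Wh *ᵥ (Whᵀ *ᵥ (Wh *ᵥ x)) = Wh *ᵥ x := by
      rw [Matrix.mulVec_mulVec x, hWh, Matrix.one_mulVec]
    rw [Matrix.mulVec_mulVec, hWhproj, Matrix.sub_mulVec, Matrix.one_mulVec,
      ← Matrix.mulVec_mulVec (Wh *ᵥ x) Vh] at this
    simpa using this
  have hpos := tp_pos hxne
  rw [← g2] at g1 hpos
  generalize Wh *ᵥ x = w at *
  set c := Vᵀ *ᵥ w with hcdef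
  set s := w - V *ᵥ c with hs
  have hs0 : Vᵀ *ᵥ s = 0 := by
    rw [hs, Matrix.mulVec_sub, Matrix.mulVec_mulVec, hV, Matrix.one_mulVec, hcdef, sub_self]
  have hw : w = s + V *ᵥ c := by rw [hs]; abel
  have hy : w - V *ᵥ a = s + V *ᵥ (c - a) := by
    rw [hs, Matrix.mulVec_sub]; abel
  have e1 := tp_split A hA V hV _ hVA s hs0 c
  have e2 := tp_split_self V hV s hs0 c
  rw [← hw] at e1 e2
  rw [hy, tp_split A hA V hV _ hVA s hs0, tp_split_self V hV s hs0] at g0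
  have e3 : μ l * ∑ j, (c - a) j * (c - a) j ≤
      ∑ j, μ (Fin.castLE hrn.le j) * ((c - a) j * (c - a) j) := by
    rw [Finset.mul_sum]
    refine Finset.sum_le_sum fun j _ => mul_le_mul_of_nonneg_right (hμmono (by
          rw [Fin.le_def, hl]; simp; have := j.isLt; omega)) (mul_self_nonneg _)
  have e4 : ∑ j, μ (Fin.castLE hrn.le j) * (c j * c j) ≤ ρ * ∑ j, c j * c j := by
    rw [Finset.mul_sum]
    exact Finset.sum_le_sum fun j _ => mul_le_mul_of_nonneg_right
      ((le_abs_self _).trans (hρ _)) (mul_self_nonneg _)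
  have e5 := tp_norm _ ε hdist w
  rw [Matrix.sub_mulVec, ← Matrix.mulVec_mulVec, ← Matrix.mulVec_mulVec, hVh0, sub_zero,
    tp_iso V hV] at e5
  change ∑ j, c j * c j ≤ _ at e5
  have e6 : 0 ≤ ∑ j, c j * c j := tp_nonneg c
  have e7 := abs_le.1 (hρ l)
  have e8 : (ρ - μ l) * (∑ j, c j * c j) ≤ 2 * ρ * (ε ^ 2 * (w ⬝ᵥ w)) :=
    mul_le_mul (by linarith) e5 e6 (by linarith)
  refine le_of_mul_le_mul_right ?_ hpos
  have e10 : μ l * (w ⬝ᵥ w) = μ l * (s ⬝ᵥ s) + μ l * ∑ j, c j * c j := by rw [e2]; ring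
  linarith

/-- Accuracy of higher-order Ritz values obtained by deflating `A` with an inexact leading
eigenbasis `Vh` and then computing Ritz values of the deflated matrix `B = Whᵀ A Wh` from an
inexact subspace `Z`: `μ` lists the eigenvalues of the symmetric matrix `A` in decreasing order,
`V` is a top-`r` orthonormal eigenbasis of `A`, `Wh` satisfies `Wh Whᵀ = I − Vh Vhᵀ`,
`ν` lists the eigenvalues of `B` in decreasing order with top-`q` eigenbasis `Y`,
`Z` is `ε`-close to `Y`, `ξ` lists the eigenvalues of `Zᵀ B Z` in decreasing order, and
`⨆ j, |μ j|` is the spectral radius `ρ(A)`. -/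
theorem two_phase_eigenvalue_error
    (n r : ℕ) (hr : 1 ≤ r) (hrn : r < n)
    (A : Matrix (Fin n) (Fin n) ℝ) (hA : Aᵀ = A)
    (μ : Fin n → ℝ) (hμmono : Antitone μ)
    (U : Matrix (Fin n) (Fin n) ℝ) (hU : U * Uᵀ = 1)
    (hdecomp : A = U * Matrix.diagonal μ * Uᵀ)
    (V : Matrix (Fin n) (Fin r) ℝ) (hV : Vᵀ * V = 1)
    (hVA : A * V = V * Matrix.diagonal fun j : Fin r => μ (Fin.castLE hrn.le j))
    (ε : ℝ) (hε : 0 ≤ ε)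
    (Vh : Matrix (Fin n) (Fin r) ℝ) (hVh : Vhᵀ * Vh = 1)
    (hdist : sNorm (V * Vᵀ - Vh * Vhᵀ) ≤ ε)
    (Wh : Matrix (Fin n) (Fin (n - r)) ℝ) (hWh : Whᵀ * Wh = 1)
    (hWhproj : Wh * Whᵀ = 1 - Vh * Vhᵀ)
    (ν : Fin (n - r) → ℝ) (hνmono : Antitone ν)
    (P : Matrix (Fin (n - r)) (Fin (n - r)) ℝ) (hP : P * Pᵀ = 1)
    (hB : Whᵀ * A * Wh = P * Matrix.diagonal ν * Pᵀ)
    (q : ℕ) (hq : 1 ≤ q) (hqnr : q ≤ n - r)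
    (Y : Matrix (Fin (n - r)) (Fin q) ℝ) (hY : Yᵀ * Y = 1)
    (hYB : (Whᵀ * A * Wh) * Y = Y * Matrix.diagonal fun j : Fin q => ν (Fin.castLE hqnr j))
    (Z : Matrix (Fin (n - r)) (Fin q) ℝ) (hZ : Zᵀ * Z = 1)
    (hZdist : sNorm (Y * Yᵀ - Z * Zᵀ) ≤ ε)
    (ξ : Fin q → ℝ) (hξmono : Antitone ξ)
    (Pz : Matrix (Fin q) (Fin q) ℝ) (hPz : Pz * Pzᵀ = 1)
    (hZBZ : Zᵀ * (Whᵀ * A * Wh) * Z = Pz * Matrix.diagonal ξ * Pzᵀ)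
    (i : Fin q) :
    |μ ⟨r + i.val, by have := i.isLt; omega⟩ - ξ i| ≤ 2 * (⨆ j : Fin n, |μ j|) * ε ^ 2 := by
  have hbdd : BddAbove (Set.range fun j : Fin n => |μ j|) := (Set.finite_range _).bddAbove
  have hρ : ∀ j, |μ j| ≤ ⨆ j : Fin n, |μ j| := fun j => le_ciSup hbdd j
  generalize (⨆ j : Fin n, |μ j|) = ρ at *
  have hlow : ∀ x, -ρ * (x ⬝ᵥ x) ≤ x ⬝ᵥ ((Whᵀ * A * Wh) *ᵥ x) := fun x => by
    rw [tp_comp, ← tp_iso Wh hWh]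
    exact tp_ge A U μ hdecomp hU _ _ fun j hj => absurd hj (not_lt.2 (abs_le.1 (hρ j)).1)
  have hup : ∀ x, x ⬝ᵥ ((Whᵀ * A * Wh) *ᵥ x) ≤ ρ * (x ⬝ᵥ x) := fun x => by
    rw [tp_comp, ← tp_iso Wh hWh x x]
    exact tp_le A U μ hdecomp hU _ _ fun j hj => absurd hj (not_lt.2 (abs_le.1 (hρ j)).2)
  have hP' : Pᵀ * P = 1 := mul_eq_one_comm.1 hP
  have hνρ : ∀ k, |ν k| ≤ ρ := fun k => by
    have hx : Pᵀ *ᵥ (P *ᵥ Pi.single k 1) = Pi.single k (1 : ℝ) := by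
      rw [Matrix.mulVec_mulVec, hP', Matrix.one_mulVec]
    have hxx := tp_iso P hP' (Pi.single k 1) (Pi.single k 1)
    have h1 : ∀ j, j ≠ k → (Pᵀ *ᵥ (P *ᵥ Pi.single k 1)) j = 0 := fun j hj => by
      rw [hx]; simp [hj]
    have g1 := tp_ge _ P ν hB hP (P *ᵥ Pi.single k 1) (ν k) fun j hj =>
      h1 j (by rintro rfl; exact lt_irrefl _ hj)
    have g2 := tp_le _ P ν hB hP (P *ᵥ Pi.single k 1) (ν k) fun j hj =>
      h1 j (by rintro rfl; exact lt_irrefl _ hj)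
    have g3 := hlow (P *ᵥ Pi.single k 1)
    have g4 := hup (P *ᵥ Pi.single k 1)
    rw [hxx] at g1 g2 g3 g4
    have e : (Pi.single k (1 : ℝ) : Fin (n - r) → ℝ) ⬝ᵥ Pi.single k 1 = 1 := by simp
    rw [e] at g1 g2 g3 g4
    exact abs_le.2 ⟨by linarith, by linarith⟩
  have hBs : (Whᵀ * A * Wh)ᵀ = Whᵀ * A * Wh := by
    simp only [Matrix.transpose_mul, Matrix.transpose_transpose, hA, Matrix.mul_assoc]
  have k1 := tp_inter1 n r hrn A μ hμmono U hU hdecomp Vh Wh hWh hWhproj ν hνmono P hP hB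
    (Fin.castLE hqnr i) ⟨r + i.val, by have := i.isLt; omega⟩ rfl
  have k2 := tp_inter2 (n - r) q hqnr _ ν hνmono P hP hB Z hZ ξ hξmono Pz hPz hZBZ i
  have k3 := tp_part1 (n - r) q hqnr _ hBs ρ ε hlow ν hνmono hνρ Y hY hYB Z hZ hZdist ξ hξmono
    Pz hPz hZBZ i
  have k4 := tp_part2 n r hrn A hA μ hμmono ρ hρ U hU hdecomp V hV hVA ε Vh hVh hdist Wh hWh
    hWhproj ν hνmono P hP hB (Fin.castLE hqnr i) ⟨r + i.val, by have := i.isLt; omega⟩ rfl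
  exact abs_le.2 ⟨by linarith, by linarith⟩
end

section
/- Let E be any real m×n matrix, let 1 ≤ r ≤ n, and let V, V̂ ∈ O_{n,r} satisfy ‖VVᵀ − V̂V̂ᵀ‖₂ ≤ ε for some ε ≥ 0. Then ‖EV‖₂ ≤ √( ‖EV̂‖₂² + ε·‖E‖₂² ). -/
open Matrix

open scoped Matrix.Norms.L2Operator in
theorem sNorm_eq_l2 {m n : ℕ} (A : Matrix (Fin m) (Fin n) ℝ) : sNorm A = ‖A‖ := rfl

open scoped Matrix.Norms.L2Operator in
theorem l2_mul_transpose {m n : ℕ} (A : Matrix (Fin m) (Fin n) ℝ) : ‖A * Aᵀ‖ = ‖A‖ ^ 2 := by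
  have h := Matrix.l2_opNorm_conjTranspose_mul_self (Aᴴ)
  rw [Matrix.conjTranspose_conjTranspose, Matrix.l2_opNorm_conjTranspose,
    Matrix.conjTranspose_eq_transpose_of_trivial] at h
  rw [h, sq]

open scoped Matrix.Norms.L2Operator in
theorem davis_aux {m n r : ℕ} (E : Matrix (Fin m) (Fin n) ℝ)
    (V Vh : Matrix (Fin n) (Fin r) ℝ) (ε : ℝ) (hdist : ‖V * Vᵀ - Vh * Vhᵀ‖ ≤ ε) :
    ‖E * V‖ ^ 2 ≤ ‖E * Vh‖ ^ 2 + ε * ‖E‖ ^ 2 := by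
  rw [← l2_mul_transpose (E * V), ← l2_mul_transpose (E * Vh)]
  have key : (E * V) * (E * V)ᵀ
      = (E * Vh) * (E * Vh)ᵀ + E * (V * Vᵀ - Vh * Vhᵀ) * Eᵀ := by
    simp only [Matrix.transpose_mul, Matrix.mul_sub, Matrix.sub_mul, Matrix.mul_assoc]
    abel
  rw [key]
  refine (norm_add_le _ _).trans ?_
  have hT : ‖Eᵀ‖ = ‖E‖ := by
    rw [← Matrix.conjTranspose_eq_transpose_of_trivial, Matrix.l2_opNorm_conjTranspose]
  have h1 := Matrix.l2_opNorm_mul (E * (V * Vᵀ - Vh * Vhᵀ)) Eᵀ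
  have h2 := Matrix.l2_opNorm_mul E (V * Vᵀ - Vh * Vhᵀ)
  rw [hT] at h1
  have h3 : ‖E * (V * Vᵀ - Vh * Vhᵀ)‖ ≤ ‖E‖ * ε :=
    h2.trans (mul_le_mul_of_nonneg_left hdist (norm_nonneg _))
  have h4 := mul_le_mul_of_nonneg_right h3 (norm_nonneg E)
  linarith

/-- Computable proxy for the Davis–Kahan numerator: if `V, Vh ∈ O_{n,r}` with
`‖V Vᵀ − Vh Vhᵀ‖₂ ≤ ε`, then `‖E V‖₂ ≤ √(‖E Vh‖₂² + ε ‖E‖₂²)` for any `m × n` matrix `E`. -/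
theorem approximate_davis_kahan_numerator
    (m n r : ℕ) (hr : 1 ≤ r) (hrn : r ≤ n)
    (E : Matrix (Fin m) (Fin n) ℝ)
    (V Vh : Matrix (Fin n) (Fin r) ℝ) (hV : Vᵀ * V = 1) (hVh : Vhᵀ * Vh = 1)
    (ε : ℝ) (hε : 0 ≤ ε)
    (hdist : sNorm (V * Vᵀ - Vh * Vhᵀ) ≤ ε) :
    sNorm (E * V) ≤ Real.sqrt (sNorm (E * Vh) ^ 2 + ε * sNorm E ^ 2) := by
  apply Real.le_sqrt_of_sq_le
  simp only [sNorm_eq_l2] at hdist ⊢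
  exact davis_aux E V Vh ε hdist
end

section
/- Let d_1,…,d_n > 0, D := diag(d_1,…,d_n), and κ(D) := (max_i d_i)/(min_j d_j). Let E be a symmetric n×n real matrix with entries in {0, 1, −1}, with E_{ii} = 0 for all i, and suppose there is α ≥ 0 such that Σ_j |E_{ij}| ≤ α d_i for every i. Then ‖D^{−1/2} E D^{−1/2}‖₂ ≤ α·√( min{κ(D), rank(E)} ). -/
open Matrix

lemma schur_aux (n : ℕ) (d : Fin n → ℝ) (hdpos : ∀ i, 0 < d i)
    (E : Matrix (Fin n) (Fin n) ℝ) (hEsymm : Eᵀ = E)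
    (α : ℝ) (hα : 0 ≤ α)
    (hEbound : ∀ i, (∑ j, |E i j|) ≤ α * d i) :
    sNorm
      (Matrix.diagonal (fun i => (Real.sqrt (d i))⁻¹) * E *
        Matrix.diagonal (fun i => (Real.sqrt (d i))⁻¹)) ≤ α := by
  unfold sNorm
  refine ContinuousLinearMap.opNorm_le_bound _ hα fun x => ?_
  rw [← sq_le_sq₀ (norm_nonneg _) (by positivity), mul_pow, EuclideanSpace.norm_sq_eq,
    EuclideanSpace.norm_sq_eq]
  have key : ∀ i, ‖(LinearMap.toContinuousLinearMap (Matrix.toEuclideanLin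
      (Matrix.diagonal (fun i => (Real.sqrt (d i))⁻¹) * E *
        Matrix.diagonal (fun i => (Real.sqrt (d i))⁻¹))) x) i‖ ^ 2
      ≤ ∑ j, α * (|E i j| * ((x j) ^ 2 / d j)) := by
    intro i
    have e : (LinearMap.toContinuousLinearMap (Matrix.toEuclideanLin
      (Matrix.diagonal (fun i => (Real.sqrt (d i))⁻¹) * E *
        Matrix.diagonal (fun i => (Real.sqrt (d i))⁻¹))) x) i
        = ∑ j, (Real.sqrt (d i))⁻¹ * E i j * (Real.sqrt (d j))⁻¹ * x j := by
      simp [Matrix.toLpLin_apply, Matrix.mulVec, dotProduct, Matrix.mul_diagonal,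
        Matrix.diagonal_mul, mul_assoc]
    rw [e, Real.norm_eq_abs, sq_abs]
    have hdi := hdpos i
    have cs := Finset.sum_sq_le_sum_mul_sum_of_sq_eq_mul Finset.univ
      (r := fun j => (Real.sqrt (d i))⁻¹ * E i j * (Real.sqrt (d j))⁻¹ * x j)
      (f := fun j => |E i j|) (g := fun j => |E i j| * ((x j) ^ 2 / d j) / d i)
      (fun j _ => abs_nonneg _)
      (fun j _ => by have := hdpos j; positivity)
      (fun j _ => by
        have := hdpos j
        simp only [mul_pow, inv_pow, Real.sq_sqrt this.le, Real.sq_sqrt hdi.le]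
        rw [← sq_abs (E i j)]
        field_simp)
    refine cs.trans ?_
    rw [← Finset.mul_sum, ← Finset.sum_div]
    have hn : 0 ≤ ∑ j, |E i j| * ((x j) ^ 2 / d j) :=
      Finset.sum_nonneg fun j _ => by have := hdpos j; positivity
    calc _ ≤ (α * d i) * ((∑ j, |E i j| * ((x j) ^ 2 / d j)) / d i) := by
          gcongr
          exact hEbound i
      _ = _ := by field_simp
  refine (Finset.sum_le_sum fun i _ => key i).trans ?_
  rw [Finset.sum_comm, Finset.mul_sum]
  refine Finset.sum_le_sum fun j _ => ?_
  have hdj := hdpos j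
  rw [← Finset.mul_sum, ← Finset.sum_mul]
  have h1 : ∑ i, |E i j| ≤ α * d j := by
    refine le_trans (le_of_eq (Finset.sum_congr rfl fun i _ => ?_)) (hEbound j)
    conv_lhs => rw [← hEsymm]
    rfl
  calc _ ≤ α * ((α * d j) * ((x j) ^ 2 / d j)) := by gcongr
    _ = _ := by rw [Real.norm_eq_abs, sq_abs]; field_simp

/-- Spectral-norm bound on the symmetrically normalized sparse update matrix:
if `E` is symmetric with entries in `{0, 1, −1}`, zero diagonal, and `∑ j, |E i j| ≤ α d i`
for every `i`, then `‖D^{-1/2} E D^{-1/2}‖₂ ≤ α √(min(κ(D), rank E))`, where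
`D = diag(d)` with positive entries and `κ(D) = (⨆ i, d i)/(⨅ i, d i)`. -/
theorem normalized_sparse_update_norm_bound
    (n : ℕ) (d : Fin n → ℝ) (hdpos : ∀ i, 0 < d i)
    (E : Matrix (Fin n) (Fin n) ℝ) (hEsymm : Eᵀ = E)
    (hErange : ∀ i j, E i j = 0 ∨ E i j = 1 ∨ E i j = -1)
    (hEdiag : ∀ i, E i i = 0)
    (α : ℝ) (hα : 0 ≤ α)
    (hEbound : ∀ i, (∑ j, |E i j|) ≤ α * d i) :
    sNorm
      (Matrix.diagonal (fun i => (Real.sqrt (d i))⁻¹) * E *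
        Matrix.diagonal (fun i => (Real.sqrt (d i))⁻¹)) ≤
      α * Real.sqrt (min ((⨆ i, d i) / (⨅ i, d i)) (E.rank : ℝ)) := by
  by_cases hE : E = 0
  · subst hE
    have : sNorm (Matrix.diagonal (fun i => (Real.sqrt (d i))⁻¹) * (0 : Matrix (Fin n) (Fin n) ℝ) *
        Matrix.diagonal (fun i => (Real.sqrt (d i))⁻¹)) = 0 := by
      simp [sNorm]
    rw [this]
    positivity
  · refine (schur_aux n d hdpos E hEsymm α hα hEbound).trans ?_
    refine le_mul_of_one_le_right hα ?_
    rw [Real.one_le_sqrt]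
    have hne : Nonempty (Fin n) := by
      by_contra h
      rw [not_nonempty_iff] at h
      exact hE (Subsingleton.elim _ _)
    refine le_min ?_ ?_
    · obtain ⟨i, hi⟩ := exists_eq_ciInf_of_finite (f := d)
      rw [← hi, one_le_div (hdpos i)]
      exact le_ciSup (Set.finite_range d).bddAbove i
    · have : E.rank ≠ 0 := by
        intro h
        rw [Matrix.rank, Submodule.finrank_eq_zero, LinearMap.range_eq_bot] at h
        apply hE
        ext i j
        have h2 := congrFun (LinearMap.congr_fun h (Pi.single j 1)) i
        simpa using h2
      exact_mod_cast Nat.one_le_iff_ne_zero.mpr this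
end

section
/- Let n ≥ 2, let 0 < ε < 1, let 1 ≤ r < n, and let A be a real symmetric n×n matrix whose eigengap δ_r := λ_r(A) − λ_{r+1}(A) satisfies δ_r > 2 + ε. Let V ∈ O_{n,r} be a top-r orthonormal eigenbasis of A. Let z ∈ ℝⁿ be a random vector with independent coordinates each Gaussian with mean 0 and variance 1/n, let s be an independent random sign taking values +1 and −1 with probability 1/2 each, and set E := s·zzᵀ and Ã := A + E. Then with probability at least 1 − exp(−ε²n/32) − 1/n, every top-r orthonormal eigenbasis Ṽ ∈ O_{n,r} of Ã satisfies ‖VVᵀ − ṼṼᵀ‖₂ ≤ (2(1+ε)/δ_r)·( √(r/n) + √(2·log n / n) ). -/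
open Matrix MeasureTheory ProbabilityTheory
open scoped NNReal ENNReal

section abs
variable {E : Type*} [NormedAddCommGroup E] [InnerProductSpace ℝ E]

open scoped RealInnerProductSpace

lemma proj_norm_sq (P : E →ₗ[ℝ] E) (hP : P.IsSymmetric) (hPP : ∀ x, P (P x) = P x) (x : E) :
    ‖P x‖ ^ 2 + ‖x - P x‖ ^ 2 = ‖x‖ ^ 2 := by
  have h1 : ⟪P x, x - P x⟫ = 0 := by
    rw [inner_sub_right, hP x (P x), hPP, hP x x]; simp
  have h2 : x = P x + (x - P x) := by abel
  have h3 := norm_add_sq_real (P x) (x - P x)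
  rw [← h2, h1] at h3
  linarith

variable [FiniteDimensional ℝ E]

lemma quad_le_of_eig (T : E →ₗ[ℝ] E) (hT : T.IsSymmetric) (C : ℝ)
    (h : ∀ (l : ℝ) (x : E), ‖x‖ = 1 → T x = l • x → l ≤ C) (x : E) :
    ⟪x, T x⟫ ≤ C * ‖x‖ ^ 2 := by
  let b := hT.eigenvectorBasis rfl
  have hb : ∀ i, hT.eigenvalues rfl i ≤ C := fun i =>
    h _ (b i) (b.orthonormal.1 i) (hT.apply_eigenvectorBasis rfl i)
  have e1 : ⟪x, T x⟫ = ∑ i, hT.eigenvalues rfl i * ⟪b i, x⟫ ^ 2 := by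
    rw [← b.sum_inner_mul_inner x (T x)]
    refine Finset.sum_congr rfl fun i _ => ?_
    have : ⟪b i, T x⟫ = hT.eigenvalues rfl i * ⟪b i, x⟫ := by
      rw [← hT (b i) x, hT.apply_eigenvectorBasis rfl i]
      simp [inner_smul_left, b]
    rw [this, real_inner_comm]; ring
  have e2 : ‖x‖ ^ 2 = ∑ i, ⟪b i, x⟫ ^ 2 := (b.sum_sq_inner_right x).symm
  rw [e1, e2, Finset.mul_sum]
  exact Finset.sum_le_sum fun i _ => mul_le_mul_of_nonneg_right (hb i) (sq_nonneg _)

lemma abs_davis_kahan (P Q A B : E →ₗ[ℝ] E) (hP : P.IsSymmetric) (hPP : ∀ x, P (P x) = P x)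
    (hQ : Q.IsSymmetric) (hQQ : ∀ x, Q (Q x) = Q x)
    (hAP : ∀ x, A (P x) = P (A x)) (hBQ : ∀ x, B (Q x) = Q (B x))
    (a b d K : ℝ) (hd : 0 < d) (hK : 0 ≤ K) (hab : d ≤ b - a)
    (hb : ∀ x, P x = x → b * ‖x‖ ^ 2 ≤ ⟪x, A x⟫)
    (ha : ∀ x, Q x = 0 → ⟪x, B x⟫ ≤ a * ‖x‖ ^ 2)
    (hE : ∀ x, P x = x → ‖B x - A x‖ ≤ K * ‖x‖) (x : E) :
    ‖P x - Q (P x)‖ ≤ K / d * ‖x‖ := by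
  have hKd : 0 ≤ K / d := by positivity
  let T : E →ₗ[ℝ] E := P ∘ₗ (LinearMap.id - Q) ∘ₗ P
  have hTx : ∀ x, T x = P (P x - Q (P x)) := fun x => rfl
  have key : ∀ x y, ⟪x, T y⟫ = ⟪P x - Q (P x), P y - Q (P y)⟫ := by
    intro x y
    rw [hTx, ← hP, inner_sub_left (P x) (Q (P x)), hQ (P x)]
    simp [map_sub, hQQ]
  have hT : T.IsSymmetric := by
    intro x y
    rw [key, real_inner_comm, key, real_inner_comm]
  have hq : ⟪x, T x⟫ ≤ (K / d) ^ 2 * ‖x‖ ^ 2 := by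
    apply quad_le_of_eig T hT
    intro l x hx hl
    by_contra! hlt
    have hlpos : 0 < l := lt_of_le_of_lt (sq_nonneg _) hlt
    have hPx : P x = x := by
      have h1 : P (T x) = T x := by rw [hTx, hPP]
      rw [hl, map_smul] at h1
      exact smul_right_injective E hlpos.ne' h1
    set y := x - Q x with hy
    have hQy : Q y = 0 := by simp [hy, hQQ]
    have hTy : P y = l • x := by rw [← hl, hTx, hPx]
    have hyl : ‖y‖ ^ 2 = l := by
      have := key x x
      rw [hPx, hl, inner_smul_right, real_inner_self_eq_norm_sq, real_inner_self_eq_norm_sq, hx] at this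
      linarith
    have e1 : ⟪y, B x⟫ ≤ a * l := by
      have : ⟪y, B x⟫ = ⟪y, B y⟫ := by
        have h0 : ⟪y, B (Q x)⟫ = 0 := by rw [hBQ, ← hQ, hQy]; simp
        rw [hy, map_sub, inner_sub_right _ (B x), ← hy, h0]; ring
      rw [this, ← hyl]; exact ha y hQy
    have e2 : b * l ≤ ⟪y, A x⟫ := by
      have : ⟪y, A x⟫ = l * ⟪x, A x⟫ := by
        conv_lhs => rw [← hPx, hAP, ← hP, hTy, inner_smul_left]
        simp
      have h3 := hb x hPx
      rw [hx] at h3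
      rw [this]; nlinarith
    have e3 : -(‖y‖ * K) ≤ ⟪y, B x - A x⟫ := by
      have := abs_real_inner_le_norm y (B x - A x)
      have h4 := hE x hPx
      rw [hx] at h4
      have := neg_le_of_abs_le this
      nlinarith [norm_nonneg y]
    rw [inner_sub_right] at e3
    have e4 : d * l ≤ ‖y‖ * K := by nlinarith
    rw [← hyl] at e4 hlt hlpos
    have hypos : 0 < ‖y‖ := by
      rcases (norm_nonneg y).eq_or_lt with h | h
      · rw [← h] at hlpos; norm_num at hlpos
      · exact h
    have e5 : ‖y‖ ≤ K / d := by
      rw [le_div_iff₀ hd]; nlinarith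
    nlinarith
  rw [key, real_inner_self_eq_norm_sq, ← mul_pow] at hq
  exact (sq_le_sq₀ (norm_nonneg _) (by positivity)).1 hq

lemma abs_proj_diff (P Q : E →ₗ[ℝ] E) (hP : P.IsSymmetric) (hPP : ∀ x, P (P x) = P x)
    (hQ : Q.IsSymmetric) (hQQ : ∀ x, Q (Q x) = Q x)
    (hs : (∀ x, P x = x → Q x = 0 → x = 0) → ∀ y, Q y = y → ∃ x, P x = x ∧ Q x = y)
    (c : ℝ) (hc : 0 ≤ c) (h : ∀ x, ‖P x - Q (P x)‖ ≤ c * ‖x‖) (x : E) :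
    ‖P x - Q x‖ ≤ c * ‖x‖ := by
  have pn := proj_norm_sq P hP hPP
  have qn := proj_norm_sq Q hQ hQQ
  have h1 : ∀ y, Q y = y → ‖y - P y‖ ≤ c * ‖y‖ := by
    intro y hy
    rcases le_or_gt 1 c with h1 | h1
    · have := pn y
      have : ‖y - P y‖ ≤ ‖y‖ := by
        refine (sq_le_sq₀ (norm_nonneg _) (norm_nonneg _)).1 ?_
        nlinarith [sq_nonneg ‖P y‖]
      nlinarith [norm_nonneg y]
    · have lower : ∀ x, P x = x → (1 - c ^ 2) * ‖x‖ ^ 2 ≤ ‖Q x‖ ^ 2 := by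
        intro x hx
        have a1 := h x
        rw [hx] at a1
        have a2 := qn x
        have a3 : ‖x - Q x‖ ^ 2 ≤ (c * ‖x‖) ^ 2 := by gcongr
        nlinarith
      have hc1 : 0 < 1 - c ^ 2 := by nlinarith
      obtain ⟨u, hu, huy⟩ := hs (by
        intro x hx hq
        have := lower x hx
        rw [hq] at this
        simp at this
        have : ‖x‖ ^ 2 ≤ 0 := by nlinarith
        simpa using this) y hy
      have l1 := lower u hu
      rw [huy] at l1
      have l2 : ‖y‖ ^ 2 ≤ ‖u‖ * ‖P y‖ := by
        rw [← real_inner_self_eq_norm_sq]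
        conv_lhs => rw [← huy, hQ, huy, hy, ← hu, hP]
        exact real_inner_le_norm _ _
      have l3 : (1 - c ^ 2) * ‖y‖ ^ 2 ≤ ‖P y‖ ^ 2 := by
        rcases (norm_nonneg y).eq_or_lt with h0 | h0
        · rw [← h0]; simp
        · have : (1 - c ^ 2) * (‖y‖ ^ 2) ^ 2 ≤ ‖y‖ ^ 2 * ‖P y‖ ^ 2 := by
            calc (1 - c ^ 2) * (‖y‖ ^ 2) ^ 2 ≤ (1 - c ^ 2) * (‖u‖ * ‖P y‖) ^ 2 := by gcongr
              _ = ((1 - c ^ 2) * ‖u‖ ^ 2) * ‖P y‖ ^ 2 := by ring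
              _ ≤ _ := by gcongr
          have h02 : 0 < ‖y‖ ^ 2 := by positivity
          nlinarith
      refine (sq_le_sq₀ (norm_nonneg _) (by positivity)).1 ?_
      have := pn y
      nlinarith
  have h2 : ∀ y, ‖P (y - Q y)‖ ≤ c * ‖y - Q y‖ := by
    intro y
    set w := y - Q y with hw
    have hQw : Q w = 0 := by simp [hw, hQQ]
    have e : ‖P w‖ ^ 2 = ⟪P w - Q (P w), w⟫ := by
      rw [inner_sub_left, hQ (P w), hQw, hP w w, ← hPP w, ← hP]
      rw [hPP, real_inner_self_eq_norm_sq]; simp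
    have e2 := real_inner_le_norm (P w - Q (P w)) w
    have e3 := h (P w)
    rw [hPP] at e3
    rcases (norm_nonneg (P w)).eq_or_lt with h0 | h0
    · rw [← h0]; positivity
    · have : ‖P w‖ * ‖P w‖ ≤ ‖P w‖ * (c * ‖w‖) := by nlinarith [norm_nonneg w]
      exact le_of_mul_le_mul_left this h0
  have a1 := h1 (Q x) (hQQ x)
  have a2 := h2 x
  have a3 := qn x
  have e : P x - Q x = P (x - Q x) + -(Q x - P (Q x)) := by simp
  have orth : ⟪P (x - Q x), -(Q x - P (Q x))⟫ = 0 := by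
    rw [hP]; simp [hPP]
  have e2 := norm_add_sq_real (P (x - Q x)) (-(Q x - P (Q x)))
  rw [← e, orth, norm_neg] at e2
  refine (sq_le_sq₀ (norm_nonneg _) (by positivity)).1 ?_
  have b1 : ‖P (x - Q x)‖ ^ 2 ≤ (c * ‖x - Q x‖) ^ 2 := by gcongr
  have b2 : ‖Q x - P (Q x)‖ ^ 2 ≤ (c * ‖Q x‖) ^ 2 := by gcongr
  rw [mul_pow] at b1 b2
  rw [mul_pow, ← a3, e2]
  linarith

end abs

lemma gauss_exp_sq (v : ℝ≥0) (hv : v ≠ 0) (x : ℝ) (hx : 1 < x) :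
    ∫ y, Real.exp ((1 - 1 / x) / (2 * v) * y ^ 2) ∂(gaussianReal 0 v) = Real.sqrt x := by
  have hv' : (0 : ℝ) < v := by positivity
  rw [integral_gaussianReal_eq_integral_smul hv]
  have : ∀ y : ℝ, gaussianPDFReal 0 v y • Real.exp ((1 - 1 / x) / (2 * v) * y ^ 2) =
      (√(2 * Real.pi * v))⁻¹ * Real.exp (-(1 / (2 * v * x)) * y ^ 2) := by
    intro y
    rw [gaussianPDFReal_def, smul_eq_mul, mul_assoc, ← Real.exp_add]
    congr 2
    field_simp
    ring
  simp_rw [this]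
  rw [integral_const_mul, integral_gaussian, ← Real.sqrt_inv, ← Real.sqrt_mul (by positivity)]
  congr 1
  field_simp

lemma chi_tail (m : ℕ) (v : ℝ≥0) (hv : v ≠ 0) (x : ℝ) (hx : 1 < x) :
    (Measure.pi fun _ : Fin m => gaussianReal 0 v).real {y | m * x * v ≤ ∑ i, y i ^ 2} ≤
      Real.exp (-(m / 2 * (x - 1 - Real.log x))) := by
  have hv' : (0 : ℝ) < v := by positivity
  have h1 := gauss_exp_sq v hv x hx
  set t := (1 - 1 / x) / (2 * (v : ℝ)) with ht
  have ht0 : 0 ≤ t := by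
    have : 1 / x ≤ 1 := by rw [div_le_one (by linarith)]; linarith
    have : 0 ≤ 1 - 1 / x := by linarith
    positivity
  have hint1 : Integrable (fun y => Real.exp (t * y ^ 2)) (gaussianReal 0 v) := by
    by_contra hc
    rw [integral_undef hc] at h1
    have := Real.sqrt_pos.2 (show 0 < x by linarith)
    linarith
  have hfun : (fun y : Fin m → ℝ => Real.exp (t * ∑ i, y i ^ 2)) =
      fun y => ∏ i, Real.exp (t * y i ^ 2) := by
    ext y; rw [Finset.mul_sum, Real.exp_sum]
  have hint : Integrable (fun y : Fin m → ℝ => Real.exp (t * ∑ i, y i ^ 2))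
      (Measure.pi fun _ : Fin m => gaussianReal 0 v) := by
    rw [hfun]
    exact Integrable.fintype_prod (fun _ => hint1)
  have hm : mgf (fun y : Fin m → ℝ => ∑ i, y i ^ 2)
      (Measure.pi fun _ : Fin m => gaussianReal 0 v) t = Real.sqrt x ^ m := by
    rw [mgf, hfun, integral_fintype_prod_eq_prod (fun _ y => Real.exp (t * y ^ 2))]
    simp [h1]
  refine (measure_ge_le_exp_mul_mgf _ ht0 hint).trans ?_
  rw [hm]
  have : Real.sqrt x ^ m = Real.exp (m / 2 * Real.log x) := by
    rw [Real.sqrt_eq_rpow, ← Real.rpow_natCast, ← Real.rpow_mul (by linarith),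
      Real.rpow_def_of_pos (by linarith)]
    congr 1; ring
  rw [this, ← Real.exp_add]
  apply le_of_eq
  congr 1
  rw [ht]
  field_simp
  ring

lemma charFun_pi_gauss (m : ℕ) (v : ℝ≥0) (t : EuclideanSpace ℝ (Fin m)) :
    charFun ((Measure.pi fun _ : Fin m => gaussianReal 0 v).map (WithLp.toLp 2)) t =
      Complex.exp (-(v * ‖t‖ ^ 2 / 2 : ℝ)) := by
  simp_rw [charFun_pi, charFun_gaussianReal, ← Complex.exp_sum, EuclideanSpace.real_norm_sq_eq]
  congr 1
  push_cast
  simp [Finset.sum_div, Finset.mul_sum]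

lemma gauss_proj (n m : ℕ) (v : ℝ≥0) (V : Matrix (Fin n) (Fin m) ℝ) (hV : Vᵀ * V = 1) :
    (Measure.pi fun _ : Fin n => gaussianReal 0 v).map (fun z => Vᵀ *ᵥ z) =
      Measure.pi fun _ : Fin m => gaussianReal 0 v := by
  have hmeas : Measurable (fun z : Fin n → ℝ => Vᵀ *ᵥ z) :=
    (Continuous.matrix_mulVec continuous_const continuous_id).measurable
  have key : ((Measure.pi fun _ : Fin n => gaussianReal 0 v).map (fun z => Vᵀ *ᵥ z)).map
        (MeasurableEquiv.toLp 2 (Fin m → ℝ)) =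
      (Measure.pi fun _ : Fin m => gaussianReal 0 v).map (MeasurableEquiv.toLp 2 (Fin m → ℝ)) := by
    have : IsProbabilityMeasure
      ((Measure.pi fun _ : Fin n => gaussianReal 0 v).map (fun z => Vᵀ *ᵥ z)) :=
        Measure.isProbabilityMeasure_map hmeas.aemeasurable
    apply Measure.ext_of_charFun (E := EuclideanSpace ℝ (Fin m))
    ext t
    have h1 := charFun_pi_gauss m v t
    have h2 := charFun_pi_gauss n v (WithLp.toLp 2 (V *ᵥ WithLp.ofLp t))
    rw [MeasurableEquiv.coe_toLp, h1, Measure.map_map (by fun_prop) hmeas]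
    have hn : ‖WithLp.toLp 2 (V *ᵥ WithLp.ofLp t)‖ ^ 2 = ‖t‖ ^ 2 := by
      rw [← real_inner_self_eq_norm_sq, ← real_inner_self_eq_norm_sq,
        EuclideanSpace.inner_toLp_toLp]
      simp only [star_trivial]
      rw [Matrix.dotProduct_mulVec, ← Matrix.mulVec_transpose, Matrix.mulVec_mulVec, hV, one_mulVec]
      rfl
    rw [hn] at h2
    rw [← h2, charFun_apply, charFun_apply, integral_map (by fun_prop) (by fun_prop), integral_map (by fun_prop) (by fun_prop)]
    congr 1
    ext z
    congr 3
    simp only [Function.comp]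
    conv_lhs => rw [show t = WithLp.toLp 2 (WithLp.ofLp t) from rfl]
    rw [EuclideanSpace.inner_toLp_toLp, EuclideanSpace.inner_toLp_toLp]
    simp only [star_trivial]
    rw [Matrix.dotProduct_mulVec, Matrix.vecMul_transpose]
  exact (MeasurableEquiv.toLp 2 (Fin m → ℝ)).map_measurableEquiv_injective key

lemma proj_tail (n m : ℕ) (v : ℝ≥0) (hv : v ≠ 0) (V : Matrix (Fin n) (Fin m) ℝ) (hV : Vᵀ * V = 1)
    (x : ℝ) (hx : 1 < x) :
    (Measure.pi fun _ : Fin n => gaussianReal 0 v) {z | m * x * v ≤ ∑ i, (Vᵀ *ᵥ z) i ^ 2} ≤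
      ENNReal.ofReal (Real.exp (-(m / 2 * (x - 1 - Real.log x)))) := by
  have hmeas : Measurable (fun z : Fin n → ℝ => Vᵀ *ᵥ z) :=
    (Continuous.matrix_mulVec continuous_const continuous_id).measurable
  have h := chi_tail m v hv x hx
  rw [← ofReal_measureReal (measure_ne_top _ _)]
  apply ENNReal.ofReal_le_ofReal
  refine le_trans (le_of_eq ?_) h
  rw [← gauss_proj n m v V hV, map_measureReal_apply hmeas]
  · rfl
  · exact measurableSet_le (by fun_prop) (by fun_prop)

lemma log_bound (e : ℝ) (h0 : 0 < e) (h1 : e < 1) :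
    e ^ 2 / 16 ≤ (1 + e / 2) - 1 - Real.log (1 + e / 2) := by
  have h2 : Real.log (1 + e / 2) ≤ e / 2 - e ^ 2 / 16 := by
    rw [Real.log_le_iff_le_exp (by positivity)]
    have := Real.quadratic_le_exp_of_nonneg (x := e / 2 - e ^ 2 / 16) (by nlinarith)
    nlinarith
  linarith

lemma good_event (n r : ℕ) (hn : 2 ≤ n) (hr : 1 ≤ r)
    (ε : ℝ) (hε0 : 0 < ε) (hε1 : ε < 1) (V : Matrix (Fin n) (Fin r) ℝ) (hV : Vᵀ * V = 1) :
    ENNReal.ofReal (1 - Real.exp (-(ε ^ 2 * n) / 32) - 1 / n) ≤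
      (Measure.pi fun _ : Fin n => gaussianReal 0 ((n : ℝ≥0))⁻¹)
        {z | ∑ i, z i ^ 2 < 1 + ε / 2 ∧
          ∑ i, (Vᵀ *ᵥ z) i ^ 2 < (√((r : ℝ) / n) + √(2 * Real.log n / n)) ^ 2} := by
  have hn0 : (0 : ℝ) < n := by positivity
  have hr0 : (0 : ℝ) < r := by positivity
  have hn1 : (1 : ℝ) < n := by exact_mod_cast hn
  have hv : ((n : ℝ≥0))⁻¹ ≠ 0 := by positivity
  have hlog : 0 < Real.log n := Real.log_pos hn1
  set γ := Measure.pi fun _ : Fin n => gaussianReal 0 ((n : ℝ≥0))⁻¹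
  have t1 := proj_tail n n _ hv (1 : Matrix (Fin n) (Fin n) ℝ) (by simp) (1 + ε / 2) (by linarith)
  set a := √(2 * Real.log n) / √r with ha
  have ha0 : 0 < a := by positivity
  have t2 := proj_tail n r _ hv V hV ((1 + a) ^ 2) (by nlinarith)
  have e1 : (n : ℝ) * (1 + ε / 2) * ((n : ℝ≥0)⁻¹ : ℝ≥0) = 1 + ε / 2 := by
    push_cast; field_simp
  have e2 : (r : ℝ) * (1 + a) ^ 2 * ((n : ℝ≥0)⁻¹ : ℝ≥0) =
      (√((r : ℝ) / n) + √(2 * Real.log n / n)) ^ 2 := by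
    push_cast
    have : √((r : ℝ) / n) + √(2 * Real.log n / n) = √((r : ℝ) / n) * (1 + a) := by
      rw [ha, Real.sqrt_div (by positivity), Real.sqrt_div (by positivity)]
      field_simp
    rw [this, mul_pow, Real.sq_sqrt (by positivity)]
    field_simp
  rw [e1] at t1
  rw [e2] at t2
  simp only [transpose_one, one_mulVec] at t1
  have b1 : Real.exp (-(n / 2 * (1 + ε / 2 - 1 - Real.log (1 + ε / 2)))) ≤
      Real.exp (-(ε ^ 2 * n) / 32) := by
    apply Real.exp_le_exp.2
    have := log_bound ε hε0 hε1
    nlinarith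
  have b2 : Real.exp (-(r / 2 * ((1 + a) ^ 2 - 1 - Real.log ((1 + a) ^ 2)))) ≤ 1 / n := by
    have h3 : Real.log ((1 + a) ^ 2) ≤ 2 * a := by
      rw [Real.log_pow]
      have := Real.log_le_sub_one_of_pos (show 0 < 1 + a by linarith)
      push_cast; linarith
    have h4 : r * a ^ 2 = 2 * Real.log n := by
      rw [ha, div_pow, Real.sq_sqrt (by positivity), Real.sq_sqrt (by positivity)]
      field_simp
    have : (1 : ℝ) / n = Real.exp (-Real.log n) := by
      rw [Real.exp_neg, Real.exp_log hn0]; simp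
    rw [this]
    apply Real.exp_le_exp.2
    nlinarith
  have m1 : MeasurableSet {z : Fin n → ℝ | 1 + ε / 2 ≤ ∑ i, z i ^ 2} :=
    measurableSet_le (by fun_prop) (by fun_prop)
  have hmeas : Measurable (fun z : Fin n → ℝ => Vᵀ *ᵥ z) :=
    (Continuous.matrix_mulVec continuous_const continuous_id).measurable
  have m2 : MeasurableSet {z : Fin n → ℝ | (√((r : ℝ) / n) + √(2 * Real.log n / n)) ^ 2 ≤
      ∑ i, (Vᵀ *ᵥ z) i ^ 2} :=
    measurableSet_le (by fun_prop) (by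
      have : ∀ i, Measurable fun z : Fin n → ℝ => (Vᵀ *ᵥ z) i := fun i => (measurable_pi_apply i).comp hmeas
      fun_prop)
  set S1 := {z : Fin n → ℝ | 1 + ε / 2 ≤ ∑ i, z i ^ 2}
  set S2 := {z : Fin n → ℝ | (√((r : ℝ) / n) + √(2 * Real.log n / n)) ^ 2 ≤
      ∑ i, (Vᵀ *ᵥ z) i ^ 2}
  have hset : {z : Fin n → ℝ | ∑ i, z i ^ 2 < 1 + ε / 2 ∧
          ∑ i, (Vᵀ *ᵥ z) i ^ 2 < (√((r : ℝ) / n) + √(2 * Real.log n / n)) ^ 2} = (S1 ∪ S2)ᶜ := by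
    ext z; simp [S1, S2]
  rw [hset, prob_compl_eq_one_sub (m1.union m2)]
  have hu : γ (S1 ∪ S2) ≤ ENNReal.ofReal (Real.exp (-(ε ^ 2 * n) / 32) + 1 / n) := by
    rw [ENNReal.ofReal_add (by positivity) (by positivity)]
    refine (measure_union_le _ _).trans (add_le_add (t1.trans ?_) (t2.trans ?_))
    · exact ENNReal.ofReal_le_ofReal b1
    · exact ENNReal.ofReal_le_ofReal b2
  rw [sub_sub, ENNReal.ofReal_sub _ (by positivity), ENNReal.ofReal_one]
  exact tsub_le_tsub_left hu _

lemma mv_dot {m n : ℕ} (M : Matrix (Fin m) (Fin n) ℝ) (x : Fin n → ℝ) (y : Fin m → ℝ) :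
    (M *ᵥ x) ⬝ᵥ y = x ⬝ᵥ (Mᵀ *ᵥ y) := by
  rw [dotProduct_comm, Matrix.dotProduct_mulVec, ← Matrix.mulVec_transpose, dotProduct_comm]

lemma orth_dot {m n : ℕ} (M : Matrix (Fin m) (Fin n) ℝ) (hM : Mᵀ * M = 1) (x : Fin n → ℝ) :
    (M *ᵥ x) ⬝ᵥ (M *ᵥ x) = x ⬝ᵥ x := by
  rw [mv_dot, mulVec_mulVec, hM, one_mulVec]

lemma quad_decomp {n : ℕ} (U : Matrix (Fin n) (Fin n) ℝ) (μ : Fin n → ℝ) (x : Fin n → ℝ) :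
    x ⬝ᵥ ((U * Matrix.diagonal μ * Uᵀ) *ᵥ x) = ∑ i, μ i * (Uᵀ *ᵥ x) i ^ 2 := by
  rw [← mulVec_mulVec, ← mulVec_mulVec, dotProduct_comm, mv_dot, dotProduct]
  refine Finset.sum_congr rfl fun i _ => ?_
  rw [mulVec_diagonal]; ring

lemma self_dot {n : ℕ} (U : Matrix (Fin n) (Fin n) ℝ) (hU : U * Uᵀ = 1) (x : Fin n → ℝ) :
    x ⬝ᵥ x = ∑ i, (Uᵀ *ᵥ x) i ^ 2 := by
  rw [← orth_dot Uᵀ (by simpa using hU) x, dotProduct]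
  simp [sq]

lemma weyl {n : ℕ} (A B U U' : Matrix (Fin n) (Fin n) ℝ) (μ μ' : Fin n → ℝ)
    (hμ : Antitone μ) (hμ' : Antitone μ') (hU : U * Uᵀ = 1) (hU' : U' * U'ᵀ = 1)
    (hA : A = U * Matrix.diagonal μ * Uᵀ) (hB : B = U' * Matrix.diagonal μ' * U'ᵀ)
    (e : ℝ) (he : ∀ x, x ⬝ᵥ (B *ᵥ x) ≤ x ⬝ᵥ (A *ᵥ x) + e * (x ⬝ᵥ x)) (k : Fin n) :
    μ' k ≤ μ k + e := by
  let f : (Fin n → ℝ) →ₗ[ℝ] ({i : Fin n // i ≠ k} → ℝ) :=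
    LinearMap.pi fun i => if k < i.1 then (LinearMap.proj i.1) ∘ₗ (Matrix.mulVecLin U'ᵀ)
      else (LinearMap.proj i.1) ∘ₗ (Matrix.mulVecLin Uᵀ)
  have hf : LinearMap.ker f ≠ ⊥ := by
    apply LinearMap.ker_ne_bot_of_finrank_lt
    simp only [Module.finrank_fintype_fun_eq_card]
    exact Fintype.card_subtype_lt (x := k) (by simp)
  obtain ⟨x, hx, hx0⟩ := (Submodule.ne_bot_iff _).mp hf
  have hfx : ∀ i : {i : Fin n // i ≠ k}, f x i = 0 := fun i => by
    rw [LinearMap.mem_ker.1 hx]; rfl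
  have h1 : ∀ i, k < i → (U'ᵀ *ᵥ x) i = 0 := fun i hi => by
    have := hfx ⟨i, hi.ne'⟩
    simpa [f, hi, mulVec_transpose] using this
  have h2 : ∀ i, i < k → (Uᵀ *ᵥ x) i = 0 := fun i hi => by
    have := hfx ⟨i, hi.ne⟩
    simpa [f, hi.not_gt, mulVec_transpose] using this
  have q1 : μ' k * (x ⬝ᵥ x) ≤ x ⬝ᵥ (B *ᵥ x) := by
    rw [hB, quad_decomp, self_dot U' hU', Finset.mul_sum]
    refine Finset.sum_le_sum fun i _ => ?_
    rcases le_or_gt i k with h | h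
    · exact mul_le_mul_of_nonneg_right (hμ' h) (sq_nonneg _)
    · simp [h1 i h]
  have q2 : x ⬝ᵥ (A *ᵥ x) ≤ μ k * (x ⬝ᵥ x) := by
    rw [hA, quad_decomp, self_dot U hU, Finset.mul_sum]
    refine Finset.sum_le_sum fun i _ => ?_
    rcases le_or_gt k i with h | h
    · exact mul_le_mul_of_nonneg_right (hμ h) (sq_nonneg _)
    · simp [h2 i h]
  have hpos : 0 < x ⬝ᵥ x := by
    have h0 : 0 ≤ x ⬝ᵥ x := Finset.sum_nonneg fun i _ => mul_self_nonneg _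
    rcases h0.eq_or_lt with h | h
    · exact absurd (dotProduct_self_eq_zero.1 h.symm) hx0
    · exact h
  have := he x
  by_contra! hc
  nlinarith

lemma compl_quad {n r : ℕ} (hrn : r < n) (B U' : Matrix (Fin n) (Fin n) ℝ) (μ' : Fin n → ℝ)
    (hμ' : Antitone μ') (hU' : U' * U'ᵀ = 1) (hB : B = U' * Matrix.diagonal μ' * U'ᵀ)
    (W : Matrix (Fin n) (Fin r) ℝ) (hW : Wᵀ * W = 1)
    (hWB : B * W = W * Matrix.diagonal fun j : Fin r => μ' (Fin.castLE hrn.le j))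
    (hgap : ∀ j : Fin r, μ' ⟨r, hrn⟩ < μ' (Fin.castLE hrn.le j)) (y : Fin n → ℝ)
    (hy : Wᵀ *ᵥ y = 0) :
    y ⬝ᵥ (B *ᵥ y) ≤ μ' ⟨r, hrn⟩ * (y ⬝ᵥ y) := by
  have hU'2 : U'ᵀ * U' = 1 := mul_eq_one_comm.1 hU'
  set G := U'ᵀ * W with hG
  have hGe : Matrix.diagonal μ' * G = G * Matrix.diagonal fun j : Fin r => μ' (Fin.castLE hrn.le j) := by
    rw [hG, Matrix.mul_assoc U'ᵀ W, ← hWB, hB]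
    simp only [← Matrix.mul_assoc]
    rw [hU'2, Matrix.one_mul]
  have hG0 : ∀ i j, r ≤ (i : Fin n).1 → G i j = 0 := by
    intro i j hi
    have h1 := congrFun (congrFun hGe i) j
    rw [Matrix.diagonal_mul, Matrix.mul_diagonal] at h1
    have h2 := hgap j
    have h3 : μ' i ≤ μ' ⟨r, hrn⟩ := hμ' hi
    have h4 : (μ' (Fin.castLE hrn.le j) - μ' i) * G i j = 0 := by linarith
    rcases mul_eq_zero.1 h4 with h | h
    · linarith
    · exact h
  let G1 : Matrix (Fin r) (Fin r) ℝ := G.submatrix (Fin.castLE hrn.le) id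
  let J : Matrix (Fin n) (Fin r) ℝ := (1 : Matrix (Fin n) (Fin n) ℝ).submatrix id (Fin.castLE hrn.le)
  have hJ : G = J * G1 := by
    ext i j
    rw [Matrix.mul_apply]
    by_cases hi : i.1 < r
    · rw [Finset.sum_eq_single ⟨i.1, hi⟩]
      · have : (Fin.castLE hrn.le ⟨i.1, hi⟩ : Fin n) = i := rfl
        show G i j = (1 : Matrix (Fin n) (Fin n) ℝ) i i * G i j
        rw [Matrix.one_apply_eq, one_mul]
      · intro b _ hb
        have : i ≠ Fin.castLE hrn.le b := by
          intro h; apply hb; ext; simp [h]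
        simp [J, this]
      · simp
    · rw [hG0 i j (by omega), Finset.sum_eq_zero]
      intro b _
      have : i ≠ Fin.castLE hrn.le b := by
        intro h; apply hi; rw [h]; simp
      simp [J, this]
  have hJJ : Jᵀ * J = 1 := by
    ext i j
    simp [J, Matrix.mul_apply, Matrix.one_apply]
  have hG1 : G1ᵀ * G1 = 1 := by
    have : Gᵀ * G = 1 := by
      rw [hG, Matrix.transpose_mul, Matrix.transpose_transpose, Matrix.mul_assoc,
        ← Matrix.mul_assoc U', hU', Matrix.one_mul, hW]
    rw [hJ, Matrix.transpose_mul, Matrix.mul_assoc, ← Matrix.mul_assoc Jᵀ, hJJ, Matrix.one_mul] at this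
    exact this
  have hG2 : G1 * G1ᵀ = 1 := mul_eq_one_comm.1 hG1
  have hJU : Jᵀ * U'ᵀ = G1 * Wᵀ := by
    have h1 : U' * J = W * G1ᵀ := by
      have h2 : J = G * G1ᵀ := by rw [hJ, Matrix.mul_assoc, hG2, Matrix.mul_one]
      rw [h2, hG, ← Matrix.mul_assoc, ← Matrix.mul_assoc, hU', Matrix.one_mul]
    have := congrArg Matrix.transpose h1
    simpa using this
  have ht : ∀ i : Fin r, (U'ᵀ *ᵥ y) (Fin.castLE hrn.le i) = 0 := by
    intro i
    have h1 : (Jᵀ *ᵥ (U'ᵀ *ᵥ y)) i = 0 := by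
      rw [mulVec_mulVec, hJU, ← mulVec_mulVec, hy, mulVec_zero]; rfl
    have h2 : (Jᵀ *ᵥ (U'ᵀ *ᵥ y)) i = (U'ᵀ *ᵥ y) (Fin.castLE hrn.le i) := by
      generalize U'ᵀ *ᵥ y = w
      simp [J, mulVec, dotProduct, Matrix.one_apply]
    rw [← h2, h1]
  rw [hB, quad_decomp, self_dot U' hU', Finset.mul_sum]
  refine Finset.sum_le_sum fun i _ => ?_
  by_cases hi : i.1 < r
  · have := ht ⟨i.1, hi⟩
    have h3 : (U'ᵀ *ᵥ y) i = 0 := this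
    simp [h3]
  · exact mul_le_mul_of_nonneg_right (hμ' (show (⟨r, hrn⟩ : Fin n) ≤ i from by
      rw [Fin.le_def]; simpa using hi)) (sq_nonneg _)

lemma top_quad {n r : ℕ} (A : Matrix (Fin n) (Fin n) ℝ)
    (V : Matrix (Fin n) (Fin r) ℝ) (hV : Vᵀ * V = 1) (d : Fin r → ℝ)
    (hVA : A * V = V * Matrix.diagonal d) (b : ℝ) (hb : ∀ j, b ≤ d j)
    (x : Fin n → ℝ) (hx : (V * Vᵀ) *ᵥ x = x) :
    b * (x ⬝ᵥ x) ≤ x ⬝ᵥ (A *ᵥ x) := by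
  set u := Vᵀ *ᵥ x with hu
  have hxu : x = V *ᵥ u := by rw [hu, mulVec_mulVec, hx]
  clear_value u
  subst hxu
  rw [orth_dot V hV, mulVec_mulVec, hVA, ← mulVec_mulVec, mv_dot, mulVec_mulVec, hV, one_mulVec,
    dotProduct, dotProduct, Finset.mul_sum]
  refine Finset.sum_le_sum fun i _ => ?_
  rw [mulVec_diagonal]
  nlinarith [hb i, mul_self_nonneg (u i)]

lemma comm_proj {n r : ℕ} (A : Matrix (Fin n) (Fin n) ℝ) (hA : Aᵀ = A)
    (V : Matrix (Fin n) (Fin r) ℝ) (d : Fin r → ℝ)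
    (hVA : A * V = V * Matrix.diagonal d) : A * (V * Vᵀ) = (V * Vᵀ) * A := by
  have h := congrArg Matrix.transpose hVA
  simp only [Matrix.transpose_mul, Matrix.diagonal_transpose, hA] at h
  rw [← Matrix.mul_assoc, hVA, Matrix.mul_assoc, Matrix.mul_assoc, h]

lemma inner_lin {n : ℕ} (x y : EuclideanSpace ℝ (Fin n)) :
    inner ℝ x y = WithLp.ofLp x ⬝ᵥ WithLp.ofLp y := by
  rw [dotProduct_comm]; rfl

lemma symm_lin {n : ℕ} (M : Matrix (Fin n) (Fin n) ℝ) (hM : Mᵀ = M) :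
    (Matrix.toEuclideanLin M).IsSymmetric := by
  intro x y
  rw [inner_lin, inner_lin]
  simp only [Matrix.toLpLin_apply]
  rw [mv_dot, hM]

lemma mul_lin {n : ℕ} (M N : Matrix (Fin n) (Fin n) ℝ) (x : EuclideanSpace ℝ (Fin n)) :
    Matrix.toEuclideanLin M (Matrix.toEuclideanLin N x) = Matrix.toEuclideanLin (M * N) x := by
  simp only [Matrix.toLpLin_apply, mulVec_mulVec]

lemma proj_surj {n r : ℕ} (V W : Matrix (Fin n) (Fin r) ℝ) (hV : Vᵀ * V = 1)
    (h : ∀ x, (V * Vᵀ) *ᵥ x = x → (W * Wᵀ) *ᵥ x = 0 → x = 0) (y : Fin n → ℝ)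
    (hy : (W * Wᵀ) *ᵥ y = y) : ∃ x, (V * Vᵀ) *ᵥ x = x ∧ (W * Wᵀ) *ᵥ x = y := by
  have hV' : ∀ u, (V * Vᵀ) *ᵥ (V *ᵥ u) = V *ᵥ u := fun u => by
    rw [mulVec_mulVec, Matrix.mul_assoc, hV, Matrix.mul_one]
  have hinj : Function.Injective (Matrix.mulVecLin (Wᵀ * V)) := by
    rw [← LinearMap.ker_eq_bot, LinearMap.ker_eq_bot']
    intro u hu
    have hu' : (Wᵀ * V) *ᵥ u = 0 := hu
    have := h (V *ᵥ u) (hV' u) (by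
      rw [mulVec_mulVec, Matrix.mul_assoc, ← mulVec_mulVec, hu', mulVec_zero])
    rw [← one_mulVec u, ← hV, ← mulVec_mulVec, this, mulVec_zero]
  obtain ⟨u, hu⟩ := LinearMap.injective_iff_surjective.1 hinj (Wᵀ *ᵥ y)
  have hu' : (Wᵀ * V) *ᵥ u = Wᵀ *ᵥ y := hu
  refine ⟨V *ᵥ u, hV' u, ?_⟩
  rw [mulVec_mulVec, Matrix.mul_assoc, ← mulVec_mulVec, hu', mulVec_mulVec, hy]

lemma det_bound (n r : ℕ) (hr : 1 ≤ r) (hrn : r < n) (hr1 : r - 1 < n)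
    (ε : ℝ) (hε0 : 0 < ε)
    (A : Matrix (Fin n) (Fin n) ℝ) (hA : Aᵀ = A)
    (μ : Fin n → ℝ) (hμmono : Antitone μ)
    (U : Matrix (Fin n) (Fin n) ℝ) (hU : U * Uᵀ = 1)
    (hdecomp : A = U * Matrix.diagonal μ * Uᵀ)
    (hgap : 2 + ε < μ ⟨r - 1, hr1⟩ - μ ⟨r, hrn⟩)
    (V : Matrix (Fin n) (Fin r) ℝ) (hV : Vᵀ * V = 1)
    (hVA : A * V = V * Matrix.diagonal fun j : Fin r => μ (Fin.castLE hrn.le j))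
    (z : Fin n → ℝ) (s : ℝ) (hs : s ^ 2 = 1) (R : ℝ) (hR : 0 ≤ R)
    (hz1 : ∑ i, z i ^ 2 < 1 + ε / 2) (hz2 : ∑ i, (Vᵀ *ᵥ z) i ^ 2 < R ^ 2)
    (μ' : Fin n → ℝ) (U' : Matrix (Fin n) (Fin n) ℝ) (W : Matrix (Fin n) (Fin r) ℝ)
    (hμ' : Antitone μ') (hU' : U' * U'ᵀ = 1)
    (hdec' : A + s • Matrix.vecMulVec z z = U' * Matrix.diagonal μ' * U'ᵀ)
    (hW : Wᵀ * W = 1)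
    (hWB : (A + s • Matrix.vecMulVec z z) * W =
      W * Matrix.diagonal (fun j : Fin r => μ' (Fin.castLE hrn.le j))) :
    sNorm (V * Vᵀ - W * Wᵀ) ≤ 2 * (1 + ε) / (μ ⟨r - 1, hr1⟩ - μ ⟨r, hrn⟩) * R := by
  set δ := μ ⟨r - 1, hr1⟩ - μ ⟨r, hrn⟩ with hδ
  set B := A + s • Matrix.vecMulVec z z with hBdef
  have hB : Bᵀ = B := by
    rw [hBdef, Matrix.transpose_add, Matrix.transpose_smul, Matrix.transpose_vecMulVec, hA]
  have hsabs : |s| = 1 := by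
    rw [← sq_abs] at hs
    nlinarith [abs_nonneg s]
  have hs1 : s ≤ 1 := hsabs ▸ le_abs_self s
  have hs2 : -1 ≤ s := by have := neg_abs_le s; rw [hsabs] at this; exact this
  have hEx : ∀ x, B *ᵥ x = A *ᵥ x + (s * (z ⬝ᵥ x)) • z := by
    intro x
    rw [hBdef, add_mulVec, smul_mulVec, vecMulVec_mulVec, mul_smul]
    congr 2
    ext i; simp [mul_comm]
  have hzz : z ⬝ᵥ z = ∑ i, z i ^ 2 := by simp [dotProduct, sq]
  set e := z ⬝ᵥ z with he
  have he0 : 0 ≤ e := by rw [hzz]; positivity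
  rw [← hzz] at hz1
  have cs : ∀ {k : ℕ} (x y : Fin k → ℝ), (x ⬝ᵥ y) ^ 2 ≤ (x ⬝ᵥ x) * (y ⬝ᵥ y) := by
    intro k x y
    have := Finset.sum_mul_sq_le_sq_mul_sq Finset.univ x y
    simpa [dotProduct, sq] using this
  have hq : ∀ x, x ⬝ᵥ (B *ᵥ x) = x ⬝ᵥ (A *ᵥ x) + s * (z ⬝ᵥ x) ^ 2 := by
    intro x
    rw [hEx, dotProduct_add, dotProduct_smul, dotProduct_comm x z, smul_eq_mul]; ring
  have w1 : μ' ⟨r, hrn⟩ ≤ μ ⟨r, hrn⟩ + e := by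
    refine weyl A B U U' μ μ' hμmono hμ' hU hU' hdecomp hdec' e (fun x => ?_) _
    rw [hq]
    nlinarith [cs z x, sq_nonneg (z ⬝ᵥ x)]
  have w2 : μ ⟨r - 1, hr1⟩ ≤ μ' ⟨r - 1, hr1⟩ + e := by
    refine weyl B A U' U μ' μ hμ' hμmono hU' hU hdec' hdecomp e (fun x => ?_) _
    rw [hq]
    nlinarith [cs z x, sq_nonneg (z ⬝ᵥ x)]
  have hδ0 : 0 < δ := by linarith
  have hgap' : ∀ j : Fin r, μ' ⟨r, hrn⟩ < μ' (Fin.castLE hrn.le j) := by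
    intro j
    have : μ' ⟨r - 1, hr1⟩ ≤ μ' (Fin.castLE hrn.le j) := hμ' (by
      rw [Fin.le_def]; simp; omega)
    linarith
  have hb : ∀ j : Fin r, μ ⟨r - 1, hr1⟩ ≤ μ (Fin.castLE hrn.le j) := by
    intro j
    apply hμmono
    rw [Fin.le_def]; simp; omega
  have hPs : (V * Vᵀ)ᵀ = V * Vᵀ := by simp
  have hQs : (W * Wᵀ)ᵀ = W * Wᵀ := by simp
  have hPP : V * Vᵀ * (V * Vᵀ) = V * Vᵀ := by
    rw [Matrix.mul_assoc, ← Matrix.mul_assoc Vᵀ, hV, Matrix.one_mul]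
  have hQQ : W * Wᵀ * (W * Wᵀ) = W * Wᵀ := by
    rw [Matrix.mul_assoc, ← Matrix.mul_assoc Wᵀ, hW, Matrix.one_mul]
  let P := Matrix.toEuclideanLin (V * Vᵀ)
  let Q := Matrix.toEuclideanLin (W * Wᵀ)
  have fixP : ∀ x : EuclideanSpace ℝ (Fin n), P x = x → (V * Vᵀ) *ᵥ WithLp.ofLp x = WithLp.ofLp x :=
    fun x hx => congrArg WithLp.ofLp hx
  have hPPl : ∀ x, P (P x) = P x := fun x => by simp only [P, mul_lin, hPP]
  have hQQl : ∀ x, Q (Q x) = Q x := fun x => by simp only [Q, mul_lin, hQQ]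
  have hKe : (e * (R ^ 2)) ≤ ((1 + ε) * R) ^ 2 := by
    rw [mul_pow]
    apply mul_le_mul_of_nonneg_right _ (sq_nonneg R)
    nlinarith
  have dk := abs_davis_kahan P Q (Matrix.toEuclideanLin A) (Matrix.toEuclideanLin B)
    (symm_lin _ hPs) hPPl (symm_lin _ hQs) hQQl
    (fun x => by simp only [P, mul_lin, comm_proj A hA V _ hVA])
    (fun x => by simp only [Q, mul_lin, comm_proj B hB W _ hWB])
    (μ' ⟨r, hrn⟩) (μ ⟨r - 1, hr1⟩) (δ / 2) ((1 + ε) * R) (by linarith) (by positivity)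
    (by linarith)
    (fun x hx => by
      rw [← real_inner_self_eq_norm_sq, inner_lin, inner_lin]
      exact top_quad A V hV _ hVA _ hb _ (fixP x hx))
    (fun x hx => by
      rw [← real_inner_self_eq_norm_sq, inner_lin, inner_lin]
      refine compl_quad hrn B U' μ' hμ' hU' hdec' W hW hWB hgap' _ ?_
      have h0 : (W * Wᵀ) *ᵥ WithLp.ofLp x = 0 := congrArg WithLp.ofLp hx
      rw [← one_mulVec (Wᵀ *ᵥ _), ← hW, ← mulVec_mulVec, mulVec_mulVec _ W, h0, mulVec_zero])
    (fun x hx => by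
      refine (sq_le_sq₀ (norm_nonneg _) (by positivity)).1 ?_
      rw [mul_pow, ← real_inner_self_eq_norm_sq, ← real_inner_self_eq_norm_sq, inner_lin, inner_lin]
      have hx' := fixP x hx
      have hd : WithLp.ofLp (Matrix.toEuclideanLin B x - Matrix.toEuclideanLin A x) =
          (s * (z ⬝ᵥ WithLp.ofLp x)) • z := by
        rw [WithLp.ofLp_sub]
        simp only [Matrix.toLpLin_apply]
        rw [hEx]; simp
      rw [hd]
      generalize WithLp.ofLp x = w at hx'
      rw [smul_dotProduct, dotProduct_smul, ← he, smul_eq_mul, smul_eq_mul]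
      have hzw : (z ⬝ᵥ w) ^ 2 ≤ R ^ 2 * (w ⬝ᵥ w) := by
        have h1 : z ⬝ᵥ w = (Vᵀ *ᵥ z) ⬝ᵥ (Vᵀ *ᵥ w) := by
          rw [mv_dot, Matrix.transpose_transpose, mulVec_mulVec, hx']
        have h2 : (Vᵀ *ᵥ w) ⬝ᵥ (Vᵀ *ᵥ w) = w ⬝ᵥ w := by
          rw [mv_dot, Matrix.transpose_transpose, mulVec_mulVec, hx']
        have h3 : (Vᵀ *ᵥ z) ⬝ᵥ (Vᵀ *ᵥ z) = ∑ i, (Vᵀ *ᵥ z) i ^ 2 := by simp [dotProduct, sq]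
        have h4 := cs (Vᵀ *ᵥ z) (Vᵀ *ᵥ w)
        rw [← h1, h2, h3] at h4
        have h5 : 0 ≤ w ⬝ᵥ w := Finset.sum_nonneg fun i _ => mul_self_nonneg _
        nlinarith
      have h5 : 0 ≤ w ⬝ᵥ w := Finset.sum_nonneg fun i _ => mul_self_nonneg _
      calc s * (z ⬝ᵥ w) * (s * (z ⬝ᵥ w) * e) = s ^ 2 * (e * (z ⬝ᵥ w) ^ 2) := by ring
        _ = e * (z ⬝ᵥ w) ^ 2 := by rw [hs, one_mul]
        _ ≤ e * (R ^ 2 * (w ⬝ᵥ w)) := by gcongr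
        _ = (e * R ^ 2) * (w ⬝ᵥ w) := by ring
        _ ≤ _ := by gcongr)
  have hc : (1 + ε) * R / (δ / 2) = 2 * (1 + ε) / δ * R := by field_simp
  rw [hc] at dk
  have hc0 : 0 ≤ 2 * (1 + ε) / δ * R := by positivity
  have fin := abs_proj_diff P Q (symm_lin _ hPs) hPPl (symm_lin _ hQs) hQQl
    (fun h y hy => by
      obtain ⟨x, hx1, hx2⟩ := proj_surj V W hV (fun x h1 h2 => by
        have := h (WithLp.toLp 2 x) (congrArg (WithLp.toLp 2) h1) (congrArg (WithLp.toLp 2) h2)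
        exact congrArg WithLp.ofLp this) (WithLp.ofLp y) (congrArg WithLp.ofLp hy)
      exact ⟨WithLp.toLp 2 x, congrArg (WithLp.toLp 2) hx1, congrArg (WithLp.toLp 2) hx2⟩)
    _ hc0 dk
  apply ContinuousLinearMap.opNorm_le_bound _ hc0
  intro x
  have := fin x
  rw [LinearMap.coe_toContinuousLinearMap', map_sub]
  exact this

/-- Davis–Kahan bound under a random rank-one perturbation `E = s · z zᵀ` with
`z ~ N(0, (1/n) I_n)` and an independent uniform sign `s`: if the symmetric matrix `A` has
eigenvalues `μ` in decreasing order with eigengap `δ_r = μ_r − μ_{r+1} > 2 + ε`, and `V` is a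
top-`r` orthonormal eigenbasis of `A`, then with probability at least
`1 − exp(−ε² n / 32) − 1/n` every top-`r` orthonormal eigenbasis `Vt` of `Ã = A + E`
(with eigenvalues `μ'` of `Ã` in decreasing order) satisfies
`‖V Vᵀ − Vt Vtᵀ‖₂ ≤ (2 (1+ε)/δ_r) (√(r/n) + √(2 log n / n))`. -/
theorem rank_one_random_perturbation_davis_kahan
    (n r : ℕ) (hn : 2 ≤ n) (hr : 1 ≤ r) (hrn : r < n)
    (ε : ℝ) (hε0 : 0 < ε) (hε1 : ε < 1)
    (A : Matrix (Fin n) (Fin n) ℝ) (hA : Aᵀ = A)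
    (μ : Fin n → ℝ) (hμmono : Antitone μ)
    (U : Matrix (Fin n) (Fin n) ℝ) (hU : U * Uᵀ = 1)
    (hdecomp : A = U * Matrix.diagonal μ * Uᵀ)
    (hgap : 2 + ε < μ ⟨r - 1, by omega⟩ - μ ⟨r, hrn⟩)
    (V : Matrix (Fin n) (Fin r) ℝ) (hV : Vᵀ * V = 1)
    (hVA : A * V = V * Matrix.diagonal fun j : Fin r => μ (Fin.castLE hrn.le j)) :
    ENNReal.ofReal (1 - Real.exp (-(ε ^ 2 * n) / 32) - 1 / n) ≤
      ((Measure.pi fun _ : Fin n => gaussianReal 0 ((n : ℝ≥0))⁻¹).prod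
          ((2⁻¹ : ℝ≥0∞) • Measure.dirac true + (2⁻¹ : ℝ≥0∞) • Measure.dirac false))
        {p : (Fin n → ℝ) × Bool |
          ∀ (μ' : Fin n → ℝ) (U' : Matrix (Fin n) (Fin n) ℝ)
            (Vt : Matrix (Fin n) (Fin r) ℝ),
            Antitone μ' → U' * U'ᵀ = 1 →
            A + (if p.2 then (1 : ℝ) else -1) • Matrix.vecMulVec p.1 p.1 =
              U' * Matrix.diagonal μ' * U'ᵀ →
            Vtᵀ * Vt = 1 →
            (A + (if p.2 then (1 : ℝ) else -1) • Matrix.vecMulVec p.1 p.1) * Vt =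
              Vt * Matrix.diagonal (fun j : Fin r => μ' (Fin.castLE hrn.le j)) →
            sNorm (V * Vᵀ - Vt * Vtᵀ) ≤
              2 * (1 + ε) / (μ ⟨r - 1, by omega⟩ - μ ⟨r, hrn⟩) *
                (Real.sqrt ((r : ℝ) / n) + Real.sqrt (2 * Real.log n / n))} := by
  have hg := good_event n r hn hr ε hε0 hε1 V hV
  set γ := Measure.pi fun _ : Fin n => gaussianReal 0 ((n : ℝ≥0))⁻¹
  set β : Measure Bool := (2⁻¹ : ℝ≥0∞) • Measure.dirac true + (2⁻¹ : ℝ≥0∞) • Measure.dirac false with hβ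
  have hβ1 : β Set.univ = 1 := by
    simp [hβ, ENNReal.inv_two_add_inv_two]
  have : IsProbabilityMeasure β := ⟨hβ1⟩
  refine hg.trans ?_
  rw [← mul_one (γ _), ← hβ1, ← Measure.prod_prod]
  apply measure_mono
  rintro ⟨z, s⟩ ⟨⟨h1, h2⟩, -⟩ μ' U' Vt hμ' hU' hd hVt hVtB
  exact det_bound n r hr hrn (by omega) ε hε0 A hA μ hμmono U hU hdecomp hgap V hV hVA z
    (if s then (1 : ℝ) else -1) (by split_ifs <;> norm_num) _ (by positivity) h1 h2
    μ' U' Vt hμ' hU' hd hVt hVtB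
end

section
/- Let D = diag(d₁,…,d_n) be a real diagonal n×n matrix and let A be a real symmetric n×n matrix. Then ‖DAD‖₂ ≤ √(rank(A)) · ‖D²A‖₂. -/
open Matrix

theorem sNorm_nonneg {m n : ℕ} (A : Matrix (Fin m) (Fin n) ℝ) : 0 ≤ sNorm A := norm_nonneg _

open scoped Matrix.Norms.L2Operator in
theorem sNorm_le_of_eig {n : ℕ} (S : Matrix (Fin n) (Fin n) ℝ) (hS : S.IsHermitian) (C : ℝ)
    (hC : 0 ≤ C) (h : ∀ i, |hS.eigenvalues i| ≤ C) : sNorm S ≤ C := by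
  rw [sNorm_eq_l2, hS.spectral_theorem, Unitary.conjStarAlgAut_apply,
    ← Unitary.coe_star, CStarRing.norm_mul_coe_unitary, CStarRing.norm_coe_unitary_mul,
    Matrix.l2_opNorm_diagonal]
  refine (pi_norm_le_iff_of_nonneg hC).2 fun i => ?_
  simpa using h i

theorem sNorm_le_strong
    (n : ℕ) (d : Fin n → ℝ) (A : Matrix (Fin n) (Fin n) ℝ) (hA : Aᵀ = A) :
    sNorm (Matrix.diagonal d * A * Matrix.diagonal d) ≤
      sNorm (Matrix.diagonal (fun i => d i ^ 2) * A) := by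
  have hS : (Matrix.diagonal d * A * Matrix.diagonal d).IsHermitian := by
    simp [Matrix.IsHermitian, Matrix.conjTranspose_eq_transpose_of_trivial, hA, Matrix.mul_assoc]
  refine sNorm_le_of_eig _ hS _ (sNorm_nonneg _) fun i => ?_
  have hv := hS.mulVec_eigenvectorBasis i
  have hn : hS.eigenvectorBasis i ≠ 0 := hS.eigenvectorBasis.orthonormal.ne_zero i
  generalize hS.eigenvalues i = l at hv ⊢
  generalize hS.eigenvectorBasis i = v at hv hn
  rcases eq_or_ne l 0 with rfl | hl
  · simpa using sNorm_nonneg _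
  set w : EuclideanSpace ℝ (Fin n) := WithLp.toLp 2 (Matrix.diagonal d *ᵥ v.ofLp) with hw
  have hw0 : w ≠ 0 := by
    intro h0
    have h1 : Matrix.diagonal d *ᵥ v.ofLp = 0 := by
      simpa [hw] using congrArg WithLp.ofLp h0
    rw [← Matrix.mulVec_mulVec, h1, Matrix.mulVec_zero] at hv
    have h2 := (smul_eq_zero.1 hv.symm).resolve_left hl
    exact hn (by ext j; simpa using congrFun h2 j)
  have hdd : Matrix.diagonal (fun i => d i ^ 2) = Matrix.diagonal d * Matrix.diagonal d := by
    simp [Matrix.diagonal_mul_diagonal, sq]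
  have he : Matrix.toEuclideanLin (Matrix.diagonal (fun i => d i ^ 2) * A) w = l • w := by
    rw [hdd, Matrix.toLpLin_apply, hw]
    rw [← WithLp.toLp_smul, ← Matrix.mulVec_smul, ← hv]
    simp only [Matrix.mulVec_mulVec, Matrix.mul_assoc]
  have hb := (LinearMap.toContinuousLinearMap (Matrix.toEuclideanLin
    (Matrix.diagonal (fun i => d i ^ 2) * A))).le_opNorm w
  rw [LinearMap.coe_toContinuousLinearMap', he, norm_smul, Real.norm_eq_abs] at hb
  exact le_of_mul_le_mul_right hb (norm_pos_iff.2 hw0)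

/-- For a real diagonal matrix `D = diag(d)` and a real symmetric matrix `A`,
`‖D A D‖₂ ≤ √(rank A) ‖D² A‖₂`. -/
theorem dad_spectral_norm_bound
    (n : ℕ) (d : Fin n → ℝ) (A : Matrix (Fin n) (Fin n) ℝ) (hA : Aᵀ = A) :
    sNorm (Matrix.diagonal d * A * Matrix.diagonal d) ≤
      Real.sqrt (A.rank : ℝ) * sNorm (Matrix.diagonal (fun i => d i ^ 2) * A) := by
  rcases Nat.eq_zero_or_pos A.rank with h | h
  · have h0 : A = 0 := by
      have h1 : LinearMap.range A.mulVecLin = ⊥ := Submodule.finrank_eq_zero.1 h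
      rw [LinearMap.range_eq_bot] at h1
      exact Matrix.toLin'.injective (by rw [Matrix.toLin'_apply', h1, map_zero])
    subst h0
    simp [sNorm]
  · refine (sNorm_le_strong n d A hA).trans (le_mul_of_one_le_left (sNorm_nonneg _) ?_)
    rw [Real.one_le_sqrt]
    exact_mod_cast h
end

section
/- Fix positive integers n₁, n₂, r and let 𝒳_r := { X ∈ ℝ^{n₁×n₂} : rank(X) ≤ r and ‖X‖_F ≤ 1 }. Then for every 0 < ε ≤ 1 there exists a finite subset S ⊆ 𝒳_r with cardinality |S| ≤ (9/ε)^{(n₁+n₂+1)·r} such that every X ∈ 𝒳_r is within Frobenius distance ε of some element of S, i.e., for every X ∈ 𝒳_r there is Y ∈ S with ‖X − Y‖_F ≤ ε. -/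
open Matrix

/-- The Frobenius norm of a real matrix. -/
noncomputable def fNorm {m n : ℕ} (A : Matrix (Fin m) (Fin n) ℝ) : ℝ :=
  Real.sqrt (Matrix.trace (Aᵀ * A))

section NetLemma
open MeasureTheory Measure Metric Set

theorem sep_card {E : Type*} [NormedAddCommGroup E] [NormedSpace ℝ E] [FiniteDimensional ℝ E]
    (δ : ℝ) (hδ : 0 < δ) (hδ1 : δ ≤ 1) (s : Finset E) (hs : ∀ c ∈ s, ‖c‖ ≤ 1)
    (h : ∀ c ∈ s, ∀ d ∈ s, c ≠ d → δ ≤ ‖c - d‖) :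
    (s.card : ℝ) ≤ (3 / δ) ^ Module.finrank ℝ E := by
  borelize E
  let μ : Measure E := Measure.addHaar
  let ρ : ℝ := 1 + δ / 2
  have ρpos : 0 < ρ := by positivity
  set A := ⋃ c ∈ s, ball (c : E) (δ / 2) with hA
  have D : Set.Pairwise (s : Set E) (Function.onFun Disjoint (fun c => ball (c : E) (δ / 2))) := by
    rintro c hc d hd hcd
    apply ball_disjoint_ball
    rw [dist_eq_norm]
    have := h c hc d hd hcd
    linarith
  have A_subset : A ⊆ ball (0 : E) ρ := by
    refine iUnion₂_subset fun x hx => ?_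
    apply ball_subset_ball'
    rw [dist_zero_right]
    have := hs x hx
    show δ / 2 + ‖x‖ ≤ 1 + δ / 2
    linarith
  have I : (s.card : ENNReal) * ENNReal.ofReal ((δ / 2) ^ Module.finrank ℝ E) * μ (ball 0 1) ≤
      ENNReal.ofReal (ρ ^ Module.finrank ℝ E) * μ (ball 0 1) :=
    calc
      (s.card : ENNReal) * ENNReal.ofReal ((δ / 2) ^ Module.finrank ℝ E) * μ (ball 0 1) = μ A := by
        rw [hA, measure_biUnion_finset D fun c _ => measurableSet_ball]
        simp only [μ.addHaar_ball_of_pos _ (half_pos hδ), Finset.sum_const, nsmul_eq_mul, mul_assoc]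
      _ ≤ μ (ball (0 : E) ρ) := measure_mono A_subset
      _ = ENNReal.ofReal (ρ ^ Module.finrank ℝ E) * μ (ball 0 1) := by
        simp only [μ.addHaar_ball_of_pos _ ρpos]
  have J : (s.card : ENNReal) * ENNReal.ofReal ((δ / 2) ^ Module.finrank ℝ E)
      ≤ ENNReal.ofReal (ρ ^ Module.finrank ℝ E) :=
    (ENNReal.mul_le_mul_iff_left (measure_ball_pos _ _ zero_lt_one).ne' measure_ball_lt_top.ne).1 I
  rw [← ENNReal.ofReal_natCast, ← ENNReal.ofReal_mul (by positivity),
    ENNReal.ofReal_le_ofReal_iff (by positivity)] at J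
  have K : (s.card : ℝ) ≤ (ρ / (δ / 2)) ^ Module.finrank ℝ E := by
    rw [div_pow, le_div_iff₀ (by positivity)]
    exact J
  refine K.trans ?_
  gcongr ?_ ^ _
  rw [div_le_div_iff₀ (by positivity) hδ]
  show (1 + δ / 2) * δ ≤ 3 * (δ / 2)
  nlinarith

theorem exists_net (E : Type*) [NormedAddCommGroup E] [NormedSpace ℝ E] [FiniteDimensional ℝ E]
    (δ : ℝ) (hδ : 0 < δ) (hδ1 : δ ≤ 1) :
    ∃ s : Finset E, (∀ c ∈ s, ‖c‖ ≤ 1) ∧ (s.card : ℝ) ≤ (3 / δ) ^ Module.finrank ℝ E ∧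
      ∀ x : E, ‖x‖ ≤ 1 → ∃ c ∈ s, ‖x - c‖ ≤ δ := by
  classical
  let P : Finset E → Prop := fun s => (∀ c ∈ s, ‖c‖ ≤ 1) ∧
    (∀ c ∈ s, ∀ d ∈ s, c ≠ d → δ ≤ ‖c - d‖)
  let T : Set ℕ := {n | ∃ s, P s ∧ s.card = n}
  have hbd : BddAbove T := by
    refine ⟨⌈(3 / δ) ^ Module.finrank ℝ E⌉₊, ?_⟩
    rintro n ⟨s, hs, rfl⟩
    exact_mod_cast (sep_card δ hδ hδ1 s hs.1 hs.2).trans (Nat.le_ceil _)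
  have hne : T.Nonempty := ⟨0, ∅, by simp [P], rfl⟩
  obtain ⟨s, hs, hcard⟩ := Nat.sSup_mem hne hbd
  refine ⟨s, hs.1, sep_card δ hδ hδ1 s hs.1 hs.2, fun x hx => ?_⟩
  by_contra! hcon
  have hxs : x ∉ s := fun hxs => by
    have := hcon x hxs
    simp at this
    linarith
  have hP : P (insert x s) := by
    refine ⟨?_, ?_⟩
    · intro c hc
      rcases Finset.mem_insert.1 hc with rfl | hc
      · exact hx
      · exact hs.1 c hc
    · intro c hc d hd hcd
      rcases Finset.mem_insert.1 hc with hc' | hc' <;> rcases Finset.mem_insert.1 hd with hd' | hd'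
      · exact absurd (hc'.trans hd'.symm) hcd
      · rw [hc']; exact (hcon d hd').le
      · rw [norm_sub_rev, hd']; exact (hcon c hc').le
      · exact hs.2 c hc' d hd' hcd
  have := le_csSup hbd (show (insert x s).card ∈ T from ⟨_, hP, rfl⟩)
  rw [Finset.card_insert_of_notMem hxs] at this
  omega

end NetLemma

abbrev EU (n : ℕ) := EuclideanSpace ℝ (Fin n)
abbrev CO (n k : ℕ) := PiLp 2 (fun _ : Fin k => EU n)

def toM {n k : ℕ} (x : CO n k) : Matrix (Fin n) (Fin k) ℝ := Matrix.of fun i j => x j i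

def ofM {n k : ℕ} (X : Matrix (Fin n) (Fin k) ℝ) : CO n k :=
  WithLp.toLp 2 fun j => WithLp.toLp 2 fun i => X i j

def app {n m k : ℕ} (U : EU n →L[ℝ] EU m) (B : CO n k) : CO m k :=
  WithLp.toLp 2 fun j => U (B j)

theorem fNorm_toM {n k : ℕ} (x : CO n k) : fNorm (toM x) = ‖x‖ := by
  rw [fNorm, PiLp.norm_eq_of_L2]
  congr 1
  simp only [EuclideanSpace.real_norm_sq_eq]
  simp [Matrix.trace, Matrix.mul_apply, toM, sq]

theorem app_norm {n m k : ℕ} (U : EU n →L[ℝ] EU m) (B : CO n k) : ‖app U B‖ ≤ ‖U‖ * ‖B‖ := by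
  apply le_of_sq_le_sq _ (by positivity)
  rw [mul_pow, PiLp.norm_sq_eq_of_L2, PiLp.norm_sq_eq_of_L2, Finset.mul_sum]
  refine Finset.sum_le_sum fun j _ => ?_
  rw [← mul_pow]
  exact pow_le_pow_left₀ (norm_nonneg _) (U.le_opNorm _) 2

theorem toM_rank {n k : ℕ} (x : CO n k) :
    (toM x).rank = Module.finrank ℝ (Submodule.span ℝ (Set.range fun j => x j)) := by
  rw [Matrix.rank_eq_finrank_span_cols]
  have : Submodule.span ℝ (Set.range (toM x).col) =
      (Submodule.span ℝ (Set.range fun j => x j)).map (WithLp.linearEquiv 2 ℝ (Fin n → ℝ)).toLinearMap := by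
    rw [Submodule.map_span, ← Set.range_comp]
    rfl
  rw [this, LinearEquiv.finrank_map_eq]

theorem app_rank {n m k : ℕ} (U : EU n →L[ℝ] EU m) (B : CO n k) : (toM (app U B)).rank ≤ n := by
  rw [toM_rank]
  have h : Submodule.span ℝ (Set.range fun j => app U B j) ≤ LinearMap.range U.toLinearMap := by
    rw [Submodule.span_le]
    rintro _ ⟨j, rfl⟩
    exact ⟨B j, rfl⟩
  refine (Submodule.finrank_mono h).trans ((LinearMap.finrank_range_le _).trans ?_)
  simp

theorem exists_isom {m r : ℕ} (W : Submodule ℝ (EU m)) (h : Module.finrank ℝ W ≤ r) :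
    ∃ L : W →ₗᵢ[ℝ] EU r, True := by
  let b := stdOrthonormalBasis ℝ W
  let v : Fin (Module.finrank ℝ W) → EU r := fun i => EuclideanSpace.basisFun (Fin r) ℝ (Fin.castLE h i)
  have hv : Orthonormal ℝ v :=
    (EuclideanSpace.basisFun (Fin r) ℝ).orthonormal.comp _ (Fin.castLE_injective h)
  refine ⟨(b.toBasis.constr ℝ v).isometryOfOrthonormal (v := b.toBasis) ?_ ?_, trivial⟩
  · simpa using b.orthonormal
  · convert hv using 1
    ext i : 1
    exact Module.Basis.constr_basis _ _ _ _

theorem exists_factor {m k r : ℕ} (x : CO m k) (h : (toM x).rank ≤ r) :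
    ∃ (U : EU r →L[ℝ] EU m) (B : CO r k), ‖U‖ ≤ 1 ∧ ‖B‖ = ‖x‖ ∧ app U B = x := by
  rw [toM_rank] at h
  set W := Submodule.span ℝ (Set.range fun j => x j) with hW
  obtain ⟨L, -⟩ := exists_isom W h
  have hx : ∀ j, x j ∈ W := fun j => Submodule.subset_span ⟨j, rfl⟩
  refine ⟨W.subtypeL ∘L ContinuousLinearMap.adjoint L.toContinuousLinearMap,
    WithLp.toLp 2 fun j => L ⟨x j, hx j⟩, ?_, ?_, ?_⟩
  · refine (ContinuousLinearMap.opNorm_comp_le _ _).trans ?_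
    have h1 : ‖W.subtypeL‖ ≤ 1 := Submodule.norm_subtypeL_le W
    have h2 : ‖ContinuousLinearMap.adjoint L.toContinuousLinearMap‖ ≤ 1 := by
      rw [LinearIsometryEquiv.norm_map]
      exact L.norm_toContinuousLinearMap_le
    exact mul_le_one₀ h1 (ContinuousLinearMap.opNorm_nonneg _) h2
  · simp [PiLp.norm_eq_of_L2]
  · ext j : 1
    have : ContinuousLinearMap.adjoint L.toContinuousLinearMap (L ⟨x j, hx j⟩) = ⟨x j, hx j⟩ := by
      apply ext_inner_right ℝ
      intro w
      rw [ContinuousLinearMap.adjoint_inner_left]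
      exact L.inner_map_map _ _
    show ((ContinuousLinearMap.adjoint L.toContinuousLinearMap (L ⟨x j, hx j⟩) : W) : EU m) = _
    rw [this]

/-- Covering number of the set `𝒳_r` of `n₁ × n₂` real matrices of rank at most `r` inside the
unit Frobenius ball: for every `0 < ε ≤ 1` there is an `ε`-net `S ⊆ 𝒳_r` (in the Frobenius
metric) of cardinality at most `(9/ε)^{(n₁+n₂+1) r}`. -/
theorem low_rank_covering_number
    (n₁ n₂ r : ℕ) (h₁ : 0 < n₁) (h₂ : 0 < n₂) (hr : 0 < r)
    (ε : ℝ) (hε : 0 < ε) (hε1 : ε ≤ 1) :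
    ∃ S : Finset (Matrix (Fin n₁) (Fin n₂) ℝ),
      (∀ Y ∈ S, Y.rank ≤ r ∧ fNorm Y ≤ 1) ∧
      (S.card : ℝ) ≤ (9 / ε) ^ ((n₁ + n₂ + 1) * r) ∧
      ∀ X : Matrix (Fin n₁) (Fin n₂) ℝ, X.rank ≤ r → fNorm X ≤ 1 →
        ∃ Y ∈ S, fNorm (X - Y) ≤ ε := by
  classical
  obtain ⟨s, hs1, hsc, hs⟩ := exists_net (EU r →L[ℝ] EU n₁) (ε / 2) (by linarith) (by linarith)
  obtain ⟨t, ht1, htc, ht⟩ := exists_net (CO r n₂) (ε / 2) (by linarith) (by linarith)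
  have hd1 : Module.finrank ℝ (EU r →L[ℝ] EU n₁) = r * n₁ := by
    rw [← (LinearMap.toContinuousLinearMap (𝕜 := ℝ) (E := EU r) (F' := EU n₁)).finrank_eq,
      Module.finrank_linearMap]
    simp
  have hd2 : Module.finrank ℝ (CO r n₂) = n₂ * r := by
    rw [(WithLp.linearEquiv 2 ℝ (Fin n₂ → EU r)).finrank_eq, Module.finrank_pi_fintype]
    simp
  rw [hd1] at hsc
  rw [hd2] at htc
  refine ⟨(s ×ˢ t).image fun p => toM (app p.1 p.2), ?_, ?_, ?_⟩
  · intro Y hY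
    obtain ⟨⟨U, B⟩, hp, rfl⟩ := Finset.mem_image.1 hY
    rw [Finset.mem_product] at hp
    refine ⟨app_rank _ _, ?_⟩
    rw [fNorm_toM]
    exact (app_norm _ _).trans (mul_le_one₀ (hs1 _ hp.1) (norm_nonneg _) (ht1 _ hp.2))
  · have h9 : 3 / (ε / 2) ≤ 9 / ε := by
      rw [div_le_div_iff₀ (by positivity) hε]; linarith
    have h91 : 1 ≤ 9 / ε := by rw [le_div_iff₀ hε]; linarith
    calc (((s ×ˢ t).image fun p => toM (app p.1 p.2)).card : ℝ) ≤ ((s ×ˢ t).card : ℝ) := by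
          exact_mod_cast Finset.card_image_le
      _ = s.card * t.card := by rw [Finset.card_product]; push_cast; rfl
      _ ≤ (3 / (ε / 2)) ^ (r * n₁) * (3 / (ε / 2)) ^ (n₂ * r) := by gcongr
      _ ≤ (9 / ε) ^ (r * n₁) * (9 / ε) ^ (n₂ * r) := by gcongr
      _ = (9 / ε) ^ (r * n₁ + n₂ * r) := by rw [pow_add]
      _ ≤ _ := pow_le_pow_right₀ h91 (by nlinarith)
  · intro X hX hX1
    have hXo : toM (ofM X) = X := rfl
    obtain ⟨U, B, hU, hB, hUB⟩ := exists_factor (r := r) (ofM X) hX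
    rw [← hXo, fNorm_toM] at hX1
    obtain ⟨U', hU', hUd⟩ := hs U hU
    obtain ⟨B', hB', hBd⟩ := ht B (by rw [hB]; exact hX1)
    refine ⟨toM (app U' B'), Finset.mem_image.2 ⟨(U', B'), Finset.mk_mem_product hU' hB', rfl⟩, ?_⟩
    have e : X - toM (app U' B') = toM (app U (B - B') + app (U - U') B') := by
      rw [← hXo, ← hUB]
      ext i j
      simp [toM, app]
    rw [e, fNorm_toM]
    have a1 := app_norm U (B - B')
    have a2 := app_norm (U - U') B'
    have a3 : ‖U‖ * ‖B - B'‖ ≤ 1 * (ε / 2) := by gcongr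
    have a4 : ‖U - U'‖ * ‖B'‖ ≤ (ε / 2) * 1 := by
      gcongr
      exact ht1 _ hB'
    have := norm_add_le (app U (B - B')) (app (U - U') B')
    linarith
end
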